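/- arXiv:1802.06575 — 14 statements merged into one kernel-verified Lean document; each statement's English description precedes it below -/
import Mathlib

section
/- Let d ≥ 1 and let M ∈ ℚ^{d×d} be a column-stochastic matrix (all entries nonnegative and each column sums to 1). Define A = diag(M, 0, 0, 1) ∈ ℝ^{(d+3)×(d+3)} (block-diagonal with M followed by scalar blocks 0, 0, 1), the control set U = { (−x, y, z, z) ∈ ℝ^{d+3} : x ∈ ℝ^d, x ≥ 0 componentwise, 0 ≤ y ≤ x₁, ∑_{i=1}^d x_i = z, and z ≤ 1 }, the source s = (e₂, 0, 0, 0) ∈ ℝ^{d+3} (e₂ the second standard basis vector of ℝ^d), and the target t = (0, 1/2, 1, 1) ∈ ℝ^{d+3}. Then t is reachable from s in the LTI system (A, U) if and only if there exists n ≥ 1 such that (Mⁿ)_{1,2} ≥ 1/2. -/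
open Matrix

/-- `t` is reachable from `s` in the LTI system `(A, U)`: there are `T ∈ ℕ` and controls
`u₀, …, u_{T−1} ∈ U` such that the orbit `x₀ = s`, `x_{k+1} = A x_k + u_k` has
`x_T = t`. -/
def Reachable {ι : Type} [Fintype ι] (A : Matrix ι ι ℝ) (U : Set (ι → ℝ))
    (s t : ι → ℝ) : Prop :=
  ∃ (T : ℕ) (x : ℕ → ι → ℝ), x 0 = s ∧
    (∀ k < T, ∃ u ∈ U, x (k + 1) = A *ᵥ x k + u) ∧ x T = t

theorem step_aux {d : ℕ} (N : Matrix (Fin d) (Fin d) ℝ) (X : Fin d ⊕ Fin 3 → ℝ)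
    (x : Fin d → ℝ) (y z : ℝ) :
    (Matrix.fromBlocks N 0 0 (Matrix.diagonal ![0, 0, 1])) *ᵥ X
      + Sum.elim (fun i => -x i) ![y, z, z] =
    Sum.elim (fun i => (N *ᵥ (fun j => X (Sum.inl j))) i - x i) ![y, z, X (Sum.inr 2) + z] := by
  rw [Matrix.fromBlocks_mulVec]
  ext i
  rcases i with i | i
  · simp [Function.comp_def, sub_eq_add_neg]
  · fin_cases i <;> simp [Matrix.mulVec_diagonal]

theorem sum_aux {d : ℕ} (N : Matrix (Fin d) (Fin d) ℝ) (hc : ∀ j, ∑ i, N i j = 1)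
    (v : Fin d → ℝ) : ∑ i, (N *ᵥ v) i = ∑ i, v i := by
  simp only [Matrix.mulVec, dotProduct]
  rw [Finset.sum_comm]
  simp [← Finset.sum_mul, hc]

theorem real_aux (d : ℕ) (hd : 1 ≤ d) (N : Matrix (Fin d) (Fin d) ℝ)
    (hn : ∀ i j, 0 ≤ N i j) (hc : ∀ j, ∑ i, N i j = 1) (a : Fin d) :
    Reachable
      (Matrix.fromBlocks N 0 0 (Matrix.diagonal ![0, 0, 1]))
      { w : Fin d ⊕ Fin 3 → ℝ |
        ∃ (x : Fin d → ℝ) (y z : ℝ),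
          (∀ i, 0 ≤ x i) ∧ 0 ≤ y ∧ y ≤ x ⟨0, hd⟩ ∧ (∑ i, x i) = z ∧ z ≤ 1 ∧
          w = Sum.elim (fun i => -x i) ![y, z, z] }
      (Sum.elim (Pi.single a 1) ![0, 0, 0])
      (Sum.elim 0 ![1 / 2, 1, 1]) ↔
    ∃ n : ℕ, 1 ≤ n ∧ (1 : ℝ) / 2 ≤ (N ^ n) ⟨0, hd⟩ a := by
  obtain ⟨P, hP0, hP, hPe⟩ : ∃ P : ℕ → Fin d → ℝ, P 0 = Pi.single a 1 ∧
      (∀ k, N *ᵥ P k = P (k + 1)) ∧ ∀ k i, P k i = (N ^ k) i a := by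
    refine ⟨fun k => N ^ k *ᵥ (Pi.single a 1), by beta_reduce; rw [pow_zero, Matrix.one_mulVec], ?_, ?_⟩
    · intro k
      beta_reduce
      rw [Matrix.mulVec_mulVec, pow_succ']
    · intro k i
      simp
  have hPn : ∀ k i, 0 ≤ P k i := by
    intro k
    induction k with
    | zero =>
      intro i
      rw [hP0, Pi.single_apply]
      split_ifs <;> norm_num
    | succ k ih =>
      intro i
      rw [← hP]
      simp only [Matrix.mulVec, dotProduct]
      exact Finset.sum_nonneg fun j _ => mul_nonneg (hn i j) (ih j)
  have hPs : ∀ k, ∑ i, P k i = 1 := by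
    intro k
    induction k with
    | zero => simp [hP0]
    | succ k ih => rw [← hP, sum_aux N hc, ih]
  constructor
  · rintro ⟨T, X, h0, hs, hT⟩
    obtain _ | n := T
    · have := congrFun (h0.symm.trans hT) (Sum.inr 2)
      simp at this
    have hs' : ∀ k < n + 1, ∃ (x : Fin d → ℝ) (y z : ℝ),
          (∀ i, 0 ≤ x i) ∧ 0 ≤ y ∧ y ≤ x ⟨0, hd⟩ ∧ (∑ i, x i) = z ∧ z ≤ 1 ∧
          X (k + 1) = Sum.elim (fun i => (N *ᵥ (fun j => X k (Sum.inl j))) i - x i)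
            ![y, z, X k (Sum.inr 2) + z] := by
      intro k hk
      obtain ⟨u, ⟨x, y, z, h1, h2, h3, h4, h5, rfl⟩, h⟩ := hs k hk
      exact ⟨x, y, z, h1, h2, h3, h4, h5, by rw [h, step_aux]⟩
    have hmono : ∀ k < n + 1, X k (Sum.inr 2) ≤ X (k + 1) (Sum.inr 2) := by
      intro k hk
      obtain ⟨x, y, z, h1, h2, h3, h4, h5, h⟩ := hs' k hk
      have hz : 0 ≤ z := h4 ▸ Finset.sum_nonneg fun i _ => h1 i
      rw [h]
      simpa using hz
    obtain ⟨x, y, z, h1, h2, h3, h4, h5, h⟩ := hs' n (Nat.lt_succ_self n)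
    rw [hT] at h
    have ey : 1 / 2 = y := by simpa using congrFun h (Sum.inr 0)
    have ez : 1 = z := by simpa using congrFun h (Sum.inr 1)
    have ew : 1 = X n (Sum.inr 2) + z := by simpa using congrFun h (Sum.inr 2)
    have ex : ∀ i, 0 = (N *ᵥ (fun j => X n (Sum.inl j))) i - x i := fun i => by
      simpa using congrFun h (Sum.inl i)
    have wn : X n (Sum.inr 2) = 0 := by linarith
    have wlo : ∀ k, k ≤ n → 0 ≤ X k (Sum.inr 2) := by
      intro k
      induction k with
      | zero => intro _; rw [h0]; simp
      | succ k ih => intro hk; exact (ih (by omega)).trans (hmono k (by omega))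
    have whi : ∀ j k, k + j = n → X k (Sum.inr 2) ≤ 0 := by
      intro j
      induction j with
      | zero => rintro k rfl; exact wn.le
      | succ j ih => intro k hk; exact (hmono k (by omega)).trans (ih (k + 1) (by omega))
    have w0 : ∀ k, k ≤ n → X k (Sum.inr 2) = 0 := fun k hk =>
      le_antisymm (whi (n - k) k (by omega)) (wlo k hk)
    have key : ∀ k, k ≤ n → (fun j => X k (Sum.inl j)) = P k := by
      intro k
      induction k with
      | zero => intro _; rw [h0, hP0]; simp
      | succ k ih =>
        intro hk
        obtain ⟨x, y, z, h1, h2, h3, h4, h5, h⟩ := hs' k (by omega)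
        have e : X (k + 1) (Sum.inr 2) = X k (Sum.inr 2) + z := by rw [h]; simp
        rw [w0 _ hk, w0 k (by omega)] at e
        have hz : ∑ i, x i = 0 := by linarith
        rw [Finset.sum_eq_zero_iff_of_nonneg fun i _ => h1 i] at hz
        rw [← hP, ← ih (by omega)]
        ext j
        rw [h]
        simp [hz j (Finset.mem_univ j)]
    refine ⟨n + 1, by omega, ?_⟩
    have := ex ⟨0, hd⟩
    rw [key n le_rfl, hP, hPe] at this
    linarith
  · rintro ⟨n, hn1, h⟩
    obtain ⟨m, rfl⟩ : ∃ m, n = m + 1 := ⟨n - 1, by omega⟩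
    refine ⟨m + 1, fun k => if k = m + 1 then Sum.elim 0 ![1 / 2, 1, 1] else
      Sum.elim (P k) ![0, 0, 0], ?_, ?_, ?_⟩
    · simp [hP0]
    · intro k hk
      by_cases hkm : k = m
      · subst hkm
        refine ⟨_, ⟨P (k + 1), 1 / 2, 1, hPn _, by norm_num,
          by rw [hPe]; exact h, hPs _, le_rfl, rfl⟩, ?_⟩
        rw [step_aux]
        ext i
        rcases i with i | i
        · simp [hP]
        · fin_cases i <;> simp
      · refine ⟨_, ⟨0, 0, 0, by simp, le_rfl, le_rfl, by simp, by norm_num, rfl⟩, ?_⟩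
        rw [step_aux]
        ext i
        rcases i with i | i
        · simp [hP, hkm, hk.ne]
        · fin_cases i <;> simp [hkm, hk.ne]
    · simp

/-- for a column-stochastic `M ∈ ℚ^{d×d}` (`d ≥ 1`), with
`A = diag(M, 0, 0, 1)`, control set
`U = { (−x, y, z, z) : x ≥ 0, 0 ≤ y ≤ x₁, ∑ᵢ xᵢ = z ≤ 1 }`, source `s = (e₂, 0, 0, 0)`
and target `t = (0, 1/2, 1, 1)`, the target `t` is reachable from `s` iff
`(Mⁿ)_{1,2} ≥ 1/2` for some `n ≥ 1`.  The state space `ℝ^{d+3}` is encoded as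
`Fin d ⊕ Fin 3 → ℝ` and the `1`-based index pair `(1,2)` as `(0,1)` (`0`-based). -/
theorem markov_reachability_reduction (d : ℕ) (hd : 1 ≤ d)
    (M : Matrix (Fin d) (Fin d) ℚ)
    (hnonneg : ∀ i j, 0 ≤ M i j) (hcol : ∀ j, ∑ i, M i j = 1) :
    Reachable
      (Matrix.fromBlocks (M.map fun q : ℚ => (q : ℝ)) 0 0
        (Matrix.diagonal ![0, 0, 1]))
      { w : Fin d ⊕ Fin 3 → ℝ |
        ∃ (x : Fin d → ℝ) (y z : ℝ),
          (∀ i, 0 ≤ x i) ∧ 0 ≤ y ∧ y ≤ x ⟨0, hd⟩ ∧ (∑ i, x i) = z ∧ z ≤ 1 ∧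
          w = Sum.elim (fun i => -x i) ![y, z, z] }
      (Sum.elim (Pi.single (⟨1 % d, Nat.mod_lt 1 hd⟩ : Fin d) 1) ![0, 0, 0])
      (Sum.elim 0 ![1 / 2, 1, 1]) ↔
    ∃ n : ℕ, 1 ≤ n ∧ (1 : ℚ) / 2 ≤ (M ^ n) ⟨0, hd⟩ ⟨1 % d, Nat.mod_lt 1 hd⟩ := by
  rw [real_aux d hd _ (fun i j => by simpa using hnonneg i j)
    (fun j => by simpa using congrArg (fun q : ℚ => (q : ℝ)) (hcol j))]
  have e : ∀ n i j, ((M.map fun q : ℚ => (q : ℝ)) ^ n) i j = (((M ^ n) i j : ℚ) : ℝ) := by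
    intro n i j
    have := Matrix.map_pow (M := M) (f := Rat.castHom ℝ) n
    exact (congrFun (congrFun this i) j).symm
  simp only [e]
  refine exists_congr fun n => and_congr_right fun _ => ?_
  rw [← Rat.cast_le (K := ℝ)]
  norm_num
end

section
/- Let d ≥ 1 and M ∈ ℚ^{d×d}. Define A = diag(M, 2) ∈ ℝ^{(d+1)×(d+1)} (block-diagonal with M followed by the scalar block 2), the control set U = {0} ∪ { (0, x₂, …, x_d, 1) ∈ ℝ^{d+1} : x₂, …, x_d ∈ ℝ }, the source s = (e₂, 0) ∈ ℝ^{d+1} (e₂ the second standard basis vector of ℝ^d), and the target t = (0, …, 0, 1) ∈ ℝ^{d+1}. Then t is reachable from s in the LTI system (A, U) if and only if there exists n ≥ 1 such that (Mⁿ)_{1,2} = 0. -/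
open Matrix

/-- for `M ∈ ℚ^{d×d}` (`d ≥ 1`), with `A = diag(M, 2)`, control set
`U = {0} ∪ { (0, x₂, …, x_d, 1) : x₂, …, x_d ∈ ℝ }`, source `s = (e₂, 0)` and target
`t = (0, …, 0, 1)`, the target `t` is reachable from `s` iff `(Mⁿ)_{1,2} = 0` for some
`n ≥ 1`.  The state space `ℝ^{d+1}` is encoded as `Fin d ⊕ Fin 1 → ℝ` and the `1`-based
index pair `(1,2)` as `(0,1)` (`0`-based). -/
theorem skolem_reachability_reduction (d : ℕ) (hd : 1 ≤ d)
    (M : Matrix (Fin d) (Fin d) ℚ) :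
    Reachable
      (Matrix.fromBlocks (M.map fun q : ℚ => (q : ℝ)) 0 0 !![2])
      ({0} ∪ { w : Fin d ⊕ Fin 1 → ℝ |
        ∃ x : Fin d → ℝ, x ⟨0, hd⟩ = 0 ∧ w = Sum.elim x ![1] })
      (Sum.elim (Pi.single (⟨1 % d, Nat.mod_lt 1 hd⟩ : Fin d) 1) ![0])
      (Sum.elim 0 ![1]) ↔
    ∃ n : ℕ, 1 ≤ n ∧ (M ^ n) ⟨0, hd⟩ ⟨1 % d, Nat.mod_lt 1 hd⟩ = 0 := by
  set a : Fin d := ⟨0, hd⟩ with ha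
  set b : Fin d := ⟨1 % d, Nat.mod_lt 1 hd⟩ with hb
  set N : Matrix (Fin d) (Fin d) ℝ := M.map fun q : ℚ => (q : ℝ) with hN
  set e : Fin d → ℝ := Pi.single b 1 with he
  have hent : ∀ n : ℕ, (N ^ n *ᵥ e) a = (((M ^ n) a b : ℚ) : ℝ) := by
    intro n
    have h1 : N ^ n = (M ^ n).map (Rat.castHom ℝ) := by
      rw [Matrix.map_pow]; rfl
    rw [he, Matrix.mulVec_single_one, h1]
    simp [Matrix.col_apply]
  have hA : ∀ (v : Fin d → ℝ) (w : Fin 1 → ℝ),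
      Matrix.fromBlocks N 0 0 !![2] *ᵥ (Sum.elim v w) = Sum.elim (N *ᵥ v) ![2 * w 0] := by
    intro v w
    rw [Matrix.fromBlocks_mulVec]
    ext i
    rcases i with i | i
    · simp
    · fin_cases i
      simp [Matrix.mulVec, dotProduct]
  constructor
  · rintro ⟨T, x, h0, hs, hT⟩
    have inv : ∀ k ≤ T, ∃ (m : ℕ) (v : Fin d → ℝ), x k = Sum.elim v ![(m : ℝ)] ∧
        (m = 0 → v = N ^ k *ᵥ e) := by
      intro k
      induction k with
      | zero =>
        intro _
        exact ⟨0, e, by simpa using h0, fun _ => by simp⟩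
      | succ k ih =>
        intro hk
        obtain ⟨m, v, hv, hm⟩ := ih (by omega)
        obtain ⟨u, hu, hx⟩ := hs k (by omega)
        rw [hv, hA] at hx
        rcases hu with hu | ⟨y, hy, hu⟩
        · rw [Set.mem_singleton_iff] at hu
          refine ⟨2 * m, N *ᵥ v, ?_, ?_⟩
          · rw [hx, hu]; simp
          · intro h
            rw [hm (by omega), Matrix.mulVec_mulVec, pow_succ']
        · refine ⟨2 * m + 1, N *ᵥ v + y, ?_, fun h => by omega⟩
          rw [hx, hu]
          ext i
          rcases i with i | i
          · simp
          · fin_cases i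
            simp
    cases T with
    | zero =>
      rw [h0] at hT
      have := congrFun hT (Sum.inr 0)
      simp at this
    | succ k =>
      obtain ⟨m, v, hv, hm⟩ := inv k (by omega)
      obtain ⟨u, hu, hx⟩ := hs k (by omega)
      rw [hv, hA, hT] at hx
      refine ⟨k + 1, by omega, ?_⟩
      have h2 := congrFun hx (Sum.inr 0)
      have h3 := congrFun hx (Sum.inl a)
      rcases hu with hu | ⟨y, hy, hu⟩
      · rw [Set.mem_singleton_iff] at hu
        rw [hu] at h2
        simp at h2
        have : (1 : ℕ) = 2 * m := by exact_mod_cast h2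
        omega
      · rw [hu] at h2 h3
        simp at h2
        rw [hm h2] at h3
        simp only [Sum.elim_inl, Pi.add_apply, Pi.zero_apply, hy, Matrix.mulVec_mulVec,
          ← pow_succ', hent, add_zero] at h3
        exact_mod_cast h3.symm
  · rintro ⟨n, hn, h⟩
    refine ⟨n, fun k => if k < n then Sum.elim (N ^ k *ᵥ e) ![0] else Sum.elim 0 ![1],
      ?_, ?_, ?_⟩
    · have : 0 < n := hn
      simp [this]
    · intro k hk
      by_cases hk1 : k + 1 < n
      · refine ⟨0, Or.inl rfl, ?_⟩
        simp only [hk, hk1, if_true, hA]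
        simp [Matrix.mulVec_mulVec, ← pow_succ']
      · have hkn : k + 1 = n := by omega
        refine ⟨Sum.elim (-(N ^ n *ᵥ e)) ![1], Or.inr ⟨_, ?_, rfl⟩, ?_⟩
        · rw [Pi.neg_apply, hent, h]; simp
        · simp only [hk, hk1, if_true, if_false, hA]
          rw [Matrix.mulVec_mulVec, ← pow_succ', hkn]
          ext i
          rcases i with i | i
          · simp
          · fin_cases i
            simp
    · simp
end

section
/- Let A ∈ ℝ^{d×d} and let U ⊆ ℝ^d satisfy 0 ∈ U. Then for every integer M ≥ 1 and every set Q ⊆ ℝ^d: Q intersects A^*(U) if and only if Q intersects (A^M)^*(U'), where U' = A⁰(U) + A¹(U) + ⋯ + A^{M−1}(U) is the Minkowski sum of the images Aⁱ(U) for i = 0, …, M−1. -/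
open Matrix

/-- The set of states reachable from the origin:
`A^*(U) = { ∑_{i=0}^m Aⁱ uᵢ : m ∈ ℕ, u₀, …, u_m ∈ U }`. -/
def Astar {d : ℕ} (A : Matrix (Fin d) (Fin d) ℝ) (U : Set (Fin d → ℝ)) : Set (Fin d → ℝ) :=
  { y | ∃ (m : ℕ) (u : ℕ → Fin d → ℝ),
      (∀ i ≤ m, u i ∈ U) ∧ y = ∑ i ∈ Finset.range (m + 1), (A ^ i) *ᵥ u i }

theorem blocks_sum {d : ℕ} (A : Matrix (Fin d) (Fin d) ℝ) (u : ℕ → Fin d → ℝ) (M n : ℕ) :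
    ∑ i ∈ Finset.range (M * n), (A ^ i) *ᵥ u i =
      ∑ j ∈ Finset.range n, ((A ^ M) ^ j) *ᵥ
        ∑ i ∈ Finset.range M, (A ^ i) *ᵥ u (M * j + i) := by
  induction n with
  | zero => simp
  | succ n ih =>
    rw [Nat.mul_succ, Finset.sum_range_add, ih, Finset.sum_range_succ, Matrix.mulVec_sum]
    congr 1
    refine Finset.sum_congr rfl fun i _ => ?_
    rw [Matrix.mulVec_mulVec, ← pow_mul, ← pow_add]

/-- for `0 ∈ U` and `M ≥ 1`, a set `Q` meets `A^*(U)` iff it meets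
`(A^M)^*(U')`, where `U' = A⁰(U) + A¹(U) + ⋯ + A^{M-1}(U)` (Minkowski sum). -/
theorem reach_powers_reduction {d : ℕ} (A : Matrix (Fin d) (Fin d) ℝ)
    (U : Set (Fin d → ℝ)) (h0 : (0 : Fin d → ℝ) ∈ U)
    (M : ℕ) (hM : 1 ≤ M) (Q : Set (Fin d → ℝ)) :
    (Q ∩ Astar A U).Nonempty ↔
      (Q ∩ Astar (A ^ M)
        { y | ∃ u : ℕ → Fin d → ℝ,
            (∀ i < M, u i ∈ U) ∧ y = ∑ i ∈ Finset.range M, (A ^ i) *ᵥ u i }).Nonempty := by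
  have key : Astar A U = Astar (A ^ M)
        { y | ∃ u : ℕ → Fin d → ℝ,
            (∀ i < M, u i ∈ U) ∧ y = ∑ i ∈ Finset.range M, (A ^ i) *ᵥ u i } := by
    ext y
    constructor
    · rintro ⟨m, u, hu, rfl⟩
      let v : ℕ → Fin d → ℝ := fun i => if i ≤ m then u i else 0
      have hv : ∀ i, v i ∈ U := by
        intro i
        by_cases h : i ≤ m
        · simpa [v, h] using hu i h
        · simpa [v, h] using h0
      refine ⟨m, fun j => ∑ i ∈ Finset.range M, (A ^ i) *ᵥ v (M * j + i),
        fun j _ => ⟨fun i => v (M * j + i), fun i _ => hv _, rfl⟩, ?_⟩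
      rw [← blocks_sum A v M (m + 1)]
      have hle : m + 1 ≤ M * (m + 1) := Nat.le_mul_of_pos_left _ hM
      rw [← Finset.sum_subset (Finset.range_mono hle)]
      · refine Finset.sum_congr rfl fun i hi => ?_
        have h : i ≤ m := Nat.lt_succ_iff.mp (Finset.mem_range.mp hi)
        simp [v, h]
      · intro i _ hi
        have h : ¬ i ≤ m := fun h => hi (Finset.mem_range.mpr (Nat.lt_succ_of_le h))
        simp [v, h]
    · rintro ⟨m, w, hw, rfl⟩
      have hw2 : ∀ j, ∃ u : ℕ → Fin d → ℝ, j ≤ m →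
          (∀ i < M, u i ∈ U) ∧ w j = ∑ i ∈ Finset.range M, (A ^ i) *ᵥ u i := by
        intro j
        by_cases h : j ≤ m
        · obtain ⟨u, hu⟩ := hw j h
          exact ⟨u, fun _ => hu⟩
        · exact ⟨0, fun h2 => absurd h2 h⟩
      choose f hf using hw2
      have hpos : 0 < M * (m + 1) := Nat.mul_pos hM (Nat.succ_pos m)
      refine ⟨M * (m + 1) - 1, fun i => f (i / M) (i % M), fun i hi => ?_, ?_⟩
      · have h1 : i / M < m + 1 := by
          rw [Nat.div_lt_iff_lt_mul hM, Nat.mul_comm]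
          omega
        exact (hf _ (Nat.lt_succ_iff.mp h1)).1 _ (Nat.mod_lt _ hM)
      · rw [Nat.sub_add_cancel hpos, blocks_sum]
        refine Finset.sum_congr rfl fun j hj => ?_
        rw [(hf j (Nat.lt_succ_iff.mp (Finset.mem_range.mp hj))).2]
        congr 1
        refine Finset.sum_congr rfl fun i hi => ?_
        have hi2 := Finset.mem_range.mp hi
        have e1 : (M * j + i) / M = j := by
          rw [Nat.mul_add_div hM, Nat.div_eq_of_lt hi2, Nat.add_zero]
        have e2 : (M * j + i) % M = i := by
          rw [Nat.mul_add_mod, Nat.mod_eq_of_lt hi2]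
        simp only [e1, e2]
  rw [key]
end

section
/- Let A ∈ ℝ^{d×d} be invertible and let U ⊆ ℝ^d be a convex set containing 0 in its relative interior (i.e., there is an open ball B around 0 with B ∩ Span(U) ⊆ U, where Span(U) is the linear span of U). If the reachable set A^*(U) spans ℝ^d, then A^*(U) is an open subset of ℝ^d. -/
open Matrix

theorem Astar_pad {d : ℕ} {A : Matrix (Fin d) (Fin d) ℝ} {U : Set (Fin d → ℝ)}
    (h0 : (0 : Fin d → ℝ) ∈ U) {y : Fin d → ℝ} (hy : y ∈ Astar A U) :
    ∃ M : ℕ, ∀ n ≥ M, ∃ u : ℕ → Fin d → ℝ, (∀ i, u i ∈ U) ∧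
      y = ∑ i ∈ Finset.range (n + 1), (A ^ i) *ᵥ u i := by
  obtain ⟨m, u, hu, rfl⟩ := hy
  refine ⟨m, fun n hn => ⟨fun i => if i ≤ m then u i else 0, fun i => ?_, ?_⟩⟩
  · dsimp only
    split_ifs with h
    · exact hu i h
    · exact h0
  · rw [← Finset.sum_subset (Finset.range_mono (Nat.succ_le_succ hn))]
    · refine Finset.sum_congr rfl fun i hi => ?_
      dsimp only
      rw [if_pos (Nat.lt_succ_iff.1 (Finset.mem_range.1 hi))]
    · intro i _ hi
      dsimp only
      rw [if_neg (fun h => hi (Finset.mem_range.2 (Nat.lt_succ_iff.2 h))), mulVec_zero]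

theorem Astar_convex {d : ℕ} {A : Matrix (Fin d) (Fin d) ℝ} {U : Set (Fin d → ℝ)}
    (h0 : (0 : Fin d → ℝ) ∈ U) (hU : Convex ℝ U) : Convex ℝ (Astar A U) := by
  intro x hx y hy a b ha hb hab
  obtain ⟨M, hM⟩ := Astar_pad h0 hx
  obtain ⟨N, hN⟩ := Astar_pad h0 hy
  obtain ⟨u, hu, hxu⟩ := hM (max M N) (le_max_left _ _)
  obtain ⟨v, hv, hyv⟩ := hN (max M N) (le_max_right _ _)
  refine ⟨max M N, fun i => a • u i + b • v i, fun i _ => hU (hu i) (hv i) ha hb hab, ?_⟩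
  rw [hxu, hyv, Finset.smul_sum, Finset.smul_sum, ← Finset.sum_add_distrib]
  refine Finset.sum_congr rfl fun i _ => ?_
  rw [mulVec_add, mulVec_smul, mulVec_smul]

theorem Astar_shift {d : ℕ} {A : Matrix (Fin d) (Fin d) ℝ} {U : Set (Fin d → ℝ)}
    {y : Fin d → ℝ} (hy : y ∈ Astar A U) :
    ∃ k : ℕ, ∀ z ∈ Astar A U, y + (A ^ k) *ᵥ z ∈ Astar A U := by
  obtain ⟨m, u, hu, rfl⟩ := hy
  refine ⟨m + 1, ?_⟩
  rintro _ ⟨n, v, hv, rfl⟩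
  refine ⟨m + 1 + n, fun i => if i < m + 1 then u i else v (i - (m + 1)), fun i hi => ?_, ?_⟩
  · dsimp only
    split_ifs with h
    · exact hu i (by omega)
    · exact hv _ (by omega)
  · rw [add_assoc (m + 1) n 1, Finset.sum_range_add _ (m + 1) (n + 1)]
    congr 1
    · refine Finset.sum_congr rfl fun i hi => ?_
      dsimp only
      rw [if_pos (Finset.mem_range.1 hi)]
    · rw [mulVec_sum]
      refine Finset.sum_congr rfl fun i _ => ?_
      dsimp only
      rw [if_neg (by omega), mulVec_mulVec, ← pow_add, Nat.add_sub_cancel_left]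

theorem Astar_neg {d : ℕ} {A : Matrix (Fin d) (Fin d) ℝ} {U : Set (Fin d → ℝ)}
    (h0 : ∃ ε > 0, Metric.ball (0 : Fin d → ℝ) ε ∩ (Submodule.span ℝ U : Set (Fin d → ℝ)) ⊆ U)
    {y : Fin d → ℝ} (hy : y ∈ Astar A U) :
    ∃ t : ℝ, 0 < t ∧ -(t • y) ∈ Astar A U := by
  obtain ⟨ε, hε, hb⟩ := h0
  obtain ⟨m, u, hu, rfl⟩ := hy
  set C : ℝ := ∑ i ∈ Finset.range (m + 1), ‖u i‖ with hC
  have hC0 : 0 ≤ C := Finset.sum_nonneg fun i _ => norm_nonneg _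
  have ht : 0 < ε / (C + 1) := by positivity
  refine ⟨ε / (C + 1), ht, m, fun i => -((ε / (C + 1)) • u i), fun i hi => hb ⟨?_, ?_⟩, ?_⟩
  · have h1 : ‖u i‖ ≤ C := Finset.single_le_sum (f := fun i => ‖u i‖)
      (fun i _ => norm_nonneg _) (Finset.mem_range.2 (Nat.lt_succ_iff.2 hi))
    rw [mem_ball_zero_iff, norm_neg, norm_smul, Real.norm_of_nonneg ht.le, div_mul_eq_mul_div,
      div_lt_iff₀ (by positivity)]
    nlinarith
  · exact Submodule.neg_mem _ (Submodule.smul_mem _ _ (Submodule.subset_span (hu i hi)))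
  · rw [Finset.smul_sum, ← Finset.sum_neg_distrib]
    refine Finset.sum_congr rfl fun i _ => ?_
    rw [mulVec_neg, mulVec_smul]

/-- if `A` is invertible, `U` is convex and contains `0` in its relative
interior (some open ball around `0` intersected with `Span(U)` is contained in `U`),
and the reachable set `A^*(U)` spans `ℝ^d`, then `A^*(U)` is open. -/
theorem reachable_set_isOpen {d : ℕ} (A : Matrix (Fin d) (Fin d) ℝ) (hA : IsUnit A.det)
    (U : Set (Fin d → ℝ)) (hU : Convex ℝ U)
    (h0 : ∃ ε > 0, Metric.ball (0 : Fin d → ℝ) ε ∩ (Submodule.span ℝ U : Set (Fin d → ℝ)) ⊆ U)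
    (hfull : Submodule.span ℝ (Astar A U) = ⊤) :
    IsOpen (Astar A U) := by
  have hz : (0 : Fin d → ℝ) ∈ U := by
    obtain ⟨ε, hε, hb⟩ := h0
    exact hb ⟨Metric.mem_ball_self hε, Submodule.zero_mem _⟩
  have hc : Convex ℝ (Astar A U) := Astar_convex hz hU
  have hzS : (0 : Fin d → ℝ) ∈ Astar A U := ⟨0, fun _ => 0, fun _ _ => hz, by simp⟩
  have hne : (interior (Astar A U)).Nonempty := by
    rw [hc.interior_nonempty_iff_affineSpan_eq_top]
    rw [← Set.insert_eq_of_mem hzS, ← SetLike.coe_set_eq, affineSpan_insert_zero, hfull]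
    rfl
  obtain ⟨p, hp⟩ := hne
  obtain ⟨t, ht, hn⟩ := Astar_neg h0 (interior_subset hp)
  have h0i : (0 : Fin d → ℝ) ∈ interior (Astar A U) := by
    refine hc.openSegment_interior_self_subset_interior hp hn
      ⟨t / (t + 1), 1 / (t + 1), by positivity, by positivity, by field_simp, ?_⟩
    rw [smul_neg, smul_smul, ← sub_eq_add_neg, ← sub_smul]
    have : t / (t + 1) - 1 / (t + 1) * t = 0 := by ring
    rw [this, zero_smul]
  rw [isOpen_iff_mem_nhds]
  intro y hy
  obtain ⟨k, hk⟩ := Astar_shift hy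
  have hdet : IsUnit (A ^ k).det := by rw [det_pow]; exact hA.pow k
  have hcont : Continuous fun x : Fin d → ℝ => (A ^ k)⁻¹ *ᵥ (x - y) :=
    Continuous.matrix_mulVec continuous_const (continuous_id.sub continuous_const)
  have hmem : (fun x : Fin d → ℝ => (A ^ k)⁻¹ *ᵥ (x - y)) ⁻¹' (Astar A U) ∈ nhds y := by
    apply hcont.continuousAt.preimage_mem_nhds
    simpa using mem_interior_iff_mem_nhds.1 h0i
  filter_upwards [hmem] with x hx
  have := hk _ hx
  rwa [mulVec_mulVec, mul_nonsing_inv _ hdet, one_mulVec, add_sub_cancel] at this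
end

section
/- Let A ∈ ℝ^{d×d} have spectral radius ρ(A) < 1 and let U ⊆ ℝ^d be a nonempty compact set. Then A^∞(U) := { ∑_{i=0}^∞ Aⁱ uᵢ : uᵢ ∈ U for all i ∈ ℕ } is a compact set satisfying A(A^∞(U)) + U = A^∞(U), and it is the unique nonempty compact set X ⊆ ℝ^d satisfying A(X) + U = X. -/
open Matrix Pointwise

/-- The spectral radius of `A` is `< 1`: every complex eigenvalue of `A` has absolute
value `< 1`. -/
def SpecRadiusLtOne {d : ℕ} (A : Matrix (Fin d) (Fin d) ℝ) : Prop :=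
  ∀ μ ∈ spectrum ℂ (A.map Complex.ofReal), ‖μ‖ < 1

/-- `A^∞(U) = { ∑_{i=0}^∞ Aⁱ uᵢ : uᵢ ∈ U for all i }`, the sums being the limits of the
corresponding series. -/
def Ainf {d : ℕ} (A : Matrix (Fin d) (Fin d) ℝ) (U : Set (Fin d → ℝ)) : Set (Fin d → ℝ) :=
  { y | ∃ u : ℕ → Fin d → ℝ, (∀ i, u i ∈ U) ∧ HasSum (fun i => (A ^ i) *ᵥ u i) y }

section helpers
attribute [local instance] Matrix.linftyOpNormedRing Matrix.linftyOpNormedAlgebra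

lemma aux_summable {d : ℕ} (B : Matrix (Fin d) (Fin d) ℂ)
    (hB : ∀ μ ∈ spectrum ℂ B, ‖μ‖ < 1) : Summable (fun n => ‖B ^ n‖) := by
  rcases Nat.eq_zero_or_pos d with rfl | hd
  · have : (fun n => ‖B ^ n‖) = fun _ => (0:ℝ) := by
      funext n
      rw [Subsingleton.elim (B ^ n) 0, norm_zero]
    rw [this]; exact summable_zero
  have : Nonempty (Fin d) := ⟨⟨0, hd⟩⟩
  have : CompleteSpace (Matrix (Fin d) (Fin d) ℂ) := FiniteDimensional.complete ℂ _
  have h1 : spectralRadius ℂ B < (1 : NNReal) :=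
    spectrum.spectralRadius_lt_of_forall_lt B (fun k hk => by
      have := hB k hk
      exact_mod_cast this)
  obtain ⟨r, hr1, hr2⟩ := ENNReal.lt_iff_exists_nnreal_btwn.1 h1
  have hr2' : r < 1 := by exact_mod_cast hr2
  have hg := (spectrum.pow_nnnorm_pow_one_div_tendsto_nhds_spectralRadius B).eventually
    (gt_mem_nhds hr1)
  refine Summable.of_norm_bounded_eventually_nat (g := fun n => (r:ℝ) ^ n)
    (summable_geometric_of_lt_one r.2 (by exact_mod_cast hr2')) ?_
  filter_upwards [hg, Filter.eventually_gt_atTop 0] with n hn hn0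
  rw [norm_norm]
  have hn0' : (0:ℝ) < n := by exact_mod_cast hn0
  have h3 : ((‖B ^ n‖₊ : ENNReal)) ≤ (r : ENNReal) ^ n := by
    have := ENNReal.rpow_le_rpow hn.le hn0'.le
    rwa [← ENNReal.rpow_mul, one_div, inv_mul_cancel₀ hn0'.ne', ENNReal.rpow_one,
      ENNReal.rpow_natCast] at this
  have h4 : ‖B ^ n‖₊ ≤ r ^ n := by exact_mod_cast h3
  exact_mod_cast h4

lemma aux_bound {d : ℕ} (A : Matrix (Fin d) (Fin d) ℝ) (hA : SpecRadiusLtOne A) :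
    ∃ c : ℕ → ℝ, Summable c ∧ (∀ n, 0 ≤ c n) ∧
      ∀ n (v : Fin d → ℝ), ‖(A ^ n) *ᵥ v‖ ≤ c n * ‖v‖ := by
  refine ⟨fun n => ‖(A.map Complex.ofReal) ^ n‖, aux_summable _ hA, fun n => norm_nonneg _, ?_⟩
  intro n v
  have h1 : (A.map Complex.ofReal) ^ n = (A ^ n).map Complex.ofReal :=
    (map_pow (Complex.ofRealHom.mapMatrix) A n).symm
  have h2 : ‖(A ^ n).map Complex.ofReal‖ = ‖A ^ n‖ := by
    simp [Matrix.linfty_opNorm_def]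
  simp only [h1, h2]
  exact Matrix.linfty_opNorm_mulVec _ _

end helpers

theorem Ainf_compact_fixed_point {d : ℕ} (A : Matrix (Fin d) (Fin d) ℝ)
    (hA : SpecRadiusLtOne A) (U : Set (Fin d → ℝ)) (hUne : U.Nonempty) (hUc : IsCompact U) :
    IsCompact (Ainf A U) ∧
    (A.mulVec '' Ainf A U) + U = Ainf A U ∧
    ∀ X : Set (Fin d → ℝ), X.Nonempty → IsCompact X → (A.mulVec '' X) + U = X →
      X = Ainf A U := by
  obtain ⟨c, hc, hc0, hcA⟩ := aux_bound A hA
  obtain ⟨M, hM⟩ := hUc.isBounded.exists_norm_le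
  have hb : ∀ n, ∀ v ∈ U, ‖(A ^ n) *ᵥ v‖ ≤ c n * M := fun n v hv =>
    (hcA n v).trans (mul_le_mul_of_nonneg_left (hM v hv) (hc0 n))
  have hcM : Summable (fun n => c n * M) := hc.mul_right M
  have hs : ∀ u : ℕ → Fin d → ℝ, (∀ i, u i ∈ U) → Summable (fun i => (A ^ i) *ᵥ u i) :=
    fun u hu => Summable.of_norm_bounded hcM (fun i => hb i _ (hu i))
  have hcont : Continuous (A.mulVec) := Continuous.matrix_mulVec continuous_const continuous_id
  have hshift : ∀ (u : ℕ → Fin d → ℝ) y, HasSum (fun i => (A ^ i) *ᵥ u (i+1)) y →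
      HasSum (fun i => (A ^ i) *ᵥ u i) (A *ᵥ y + u 0) := by
    intro u y hy
    have h1 := hy.map (A.mulVecLin.toAddMonoidHom) hcont
    have h2 : HasSum (fun i => (A ^ (i+1)) *ᵥ u (i+1)) (A *ᵥ y) := by
      have h3 : (fun i => (A ^ (i+1)) *ᵥ u (i+1)) =
          A.mulVecLin.toAddMonoidHom ∘ fun i => (A ^ i) *ᵥ u (i+1) := by
        funext i
        simp [pow_succ', Matrix.mulVec_mulVec]
      rw [h3]
      exact h1
    have := (hasSum_nat_add_iff (f := fun i => (A ^ i) *ᵥ u i) 1).1 h2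
    simpa using this
  refine ⟨?_, ?_, ?_⟩
  · have hEq : Ainf A U = (fun u : ℕ → Fin d → ℝ => ∑' i, (A ^ i) *ᵥ u i) ''
        (Set.pi Set.univ (fun _ => U)) := by
      ext y
      constructor
      · rintro ⟨u, hu, hy⟩
        exact ⟨u, fun i _ => hu i, hy.tsum_eq⟩
      · rintro ⟨u, hu, rfl⟩
        exact ⟨u, fun i => hu i trivial, (hs u (fun i => hu i trivial)).hasSum⟩
    rw [hEq]
    refine (isCompact_univ_pi (fun _ => hUc)).image_of_continuousOn ?_
    refine continuousOn_tsum (u := fun n => c n * M) (fun i => ?_) hcM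
      (fun n u hu => hb n _ (hu n trivial))
    exact (Continuous.matrix_mulVec continuous_const (continuous_apply i)).continuousOn
  · ext y
    rw [Set.mem_add]
    constructor
    · rintro ⟨_, ⟨x, ⟨u, hu, hx⟩, rfl⟩, v, hv, rfl⟩
      obtain ⟨w, hw0, hws⟩ : ∃ w : ℕ → Fin d → ℝ, w 0 = v ∧ ∀ n, w (n+1) = u n :=
        ⟨fun n => Nat.casesOn n v u, rfl, fun _ => rfl⟩
      refine ⟨w, fun i => ?_, ?_⟩
      · cases i with
        | zero => rw [hw0]; exact hv
        | succ n => rw [hws]; exact hu _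
      · have := hshift w x (by simpa only [hws] using hx)
        rwa [hw0] at this
    · rintro ⟨u, hu, hy⟩
      have h := (hs (fun i => u (i+1)) (fun i => hu _)).hasSum
      exact ⟨_, ⟨_, ⟨_, fun i => hu (i+1), h⟩, rfl⟩, u 0, hu 0, (hshift u _ h).unique hy⟩
  · intro X hXne hXc hX
    obtain ⟨K, hK⟩ := hXc.isBounded.exists_norm_le
    have hz : ∀ x : ℕ → Fin d → ℝ, (∀ n, x n ∈ X) →
        Filter.Tendsto (fun n => (A ^ n) *ᵥ x n) Filter.atTop (nhds 0) := by
      intro x hx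
      refine squeeze_zero_norm (a := fun n => c n * K) (fun n => (hcA n _).trans
        (mul_le_mul_of_nonneg_left (hK _ (hx n)) (hc0 n))) ?_
      simpa using hc.tendsto_atTop_zero.mul_const K
    apply Set.Subset.antisymm
    · intro x0 hx0
      have hstep : ∀ x : X, ∃ z : X, ∃ v ∈ U, A *ᵥ z.1 + v = x.1 := by
        rintro ⟨x, hx⟩
        rw [← hX, Set.mem_add] at hx
        obtain ⟨_, ⟨z, hz, rfl⟩, v, hv, h⟩ := hx
        exact ⟨⟨z, hz⟩, v, hv, h⟩
      choose f g hg hfg using hstep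
      let x : ℕ → X := fun n => f^[n] ⟨x0, hx0⟩
      have hxs : ∀ n, x (n+1) = f (x n) := fun n => Function.iterate_succ_apply' f n _
      have hsum : ∀ n, ∑ i ∈ Finset.range n, (A ^ i) *ᵥ g (x i) + (A ^ n) *ᵥ (x n).1 = x0 := by
        intro n
        induction n with
        | zero => simp [x]
        | succ n ih =>
          rw [← ih, Finset.sum_range_succ, hxs, add_assoc]
          congr 1
          conv_rhs => rw [← hfg (x n)]
          rw [Matrix.mulVec_add, Matrix.mulVec_mulVec, ← pow_succ, add_comm]
      refine ⟨fun i => g (x i), fun i => hg _, ?_⟩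
      have h1 := (hs (fun i => g (x i)) (fun i => hg _)).hasSum
      have h2 := h1.tendsto_sum_nat.add (hz (fun n => (x n).1) (fun n => (x n).2))
      simp only [hsum, add_zero] at h2
      rwa [tendsto_nhds_unique h2 tendsto_const_nhds] at h1
    · rintro y ⟨u, hu, hy⟩
      obtain ⟨x, hx⟩ := hXne
      have hmem : ∀ n, ∀ u : ℕ → Fin d → ℝ, (∀ i, u i ∈ U) →
          ∑ i ∈ Finset.range n, (A ^ i) *ᵥ u i + (A ^ n) *ᵥ x ∈ X := by
        intro n
        induction n with
        | zero => intro u hu; simpa using hx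
        | succ n ih =>
          intro u hu
          rw [← hX, Set.mem_add]
          refine ⟨_, ⟨_, ih (fun i => u (i+1)) (fun i => hu _), rfl⟩, u 0, hu 0, ?_⟩
          rw [Finset.sum_range_succ', Matrix.mulVec_add, Matrix.mulVec_sum]
          simp only [Matrix.mulVec_mulVec, ← pow_succ', pow_zero, Matrix.one_mulVec]
          abel
      have h2 := hy.tendsto_sum_nat.add (hz (fun _ => x) (fun _ => hx))
      rw [add_zero] at h2
      exact hXc.isClosed.mem_of_tendsto h2 (Filter.Eventually.of_forall fun n => hmem n u hu)
end

section
/- Let A ∈ ℝ^{d×d} have spectral radius ρ(A) < 1 and let U ⊆ ℝ^d be a compact convex set with 0 ∈ U. Then the topological closure of the reachable set A^*(U) equals A^∞(U) := { ∑_{i=0}^∞ Aⁱ uᵢ : uᵢ ∈ U for all i ∈ ℕ }. -/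
open Matrix

attribute [local instance] Matrix.linftyOpNormedRing Matrix.linftyOpNormedAlgebra

theorem summable_norm_pow_aux {d : ℕ} (A : Matrix (Fin d) (Fin d) ℝ)
    (hA : SpecRadiusLtOne A) : Summable (fun n => ‖A ^ n‖) := by
  have hnorm : ∀ B : Matrix (Fin d) (Fin d) ℝ, ‖B.map Complex.ofReal‖ = ‖B‖ := by
    intro B
    simp [Matrix.linfty_opNorm_def]
  have hpow : ∀ n, (A.map Complex.ofReal) ^ n = (A ^ n).map Complex.ofReal := by
    intro n
    exact (map_pow (Complex.ofRealHom.mapMatrix) A n).symm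
  rcases Nat.eq_zero_or_pos d with hd | hd
  · subst hd
    have : ∀ n, ‖A ^ n‖ = 0 := fun n => by
      rw [Subsingleton.elim (A ^ n) 0, norm_zero]
    simp only [this]
    exact summable_zero
  have : Nonempty (Fin d) := ⟨⟨0, hd⟩⟩
  have : CompleteSpace (Matrix (Fin d) (Fin d) ℂ) := FiniteDimensional.complete ℂ _
  set a := A.map Complex.ofReal with ha
  have h1 : spectralRadius ℂ a < (1 : NNReal) :=
    spectrum.spectralRadius_lt_of_forall_lt a (fun k hk => by
      rw [← NNReal.coe_lt_coe]; simpa using hA k hk)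
  obtain ⟨r, hr1, hr2⟩ := ENNReal.lt_iff_exists_nnreal_btwn.1 h1
  have hr2' : (r : ℝ) < 1 := by exact_mod_cast hr2
  have h2 := (spectrum.pow_nnnorm_pow_one_div_tendsto_nhds_spectralRadius a).eventually_lt_const hr1
  refine Summable.of_norm_bounded_eventually_nat
    (summable_geometric_of_lt_one r.coe_nonneg hr2') ?_
  filter_upwards [h2, Filter.eventually_gt_atTop 0] with n hn hn0
  rw [norm_norm, ← hnorm, ← hpow]
  have hn0' : (0 : ℝ) < n := by exact_mod_cast hn0
  have h3 : (‖a ^ n‖₊ : ENNReal) ≤ (r : ENNReal) ^ n := by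
    have := ENNReal.rpow_le_rpow hn.le hn0'.le
    rw [← ENNReal.rpow_mul, one_div, inv_mul_cancel₀ hn0'.ne', ENNReal.rpow_one,
      ENNReal.rpow_natCast] at this
    exact this
  exact_mod_cast h3

/-- if `ρ(A) < 1` and `U` is compact convex with `0 ∈ U`, the closure of
the reachable set `A^*(U)` equals `A^∞(U)`. -/
theorem closure_Astar_eq_Ainf {d : ℕ} (A : Matrix (Fin d) (Fin d) ℝ)
    (hA : SpecRadiusLtOne A) (U : Set (Fin d → ℝ)) (hUc : IsCompact U)
    (hUconv : Convex ℝ U) (h0 : (0 : Fin d → ℝ) ∈ U) :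
    closure (Astar A U) = Ainf A U := by
  have hs := summable_norm_pow_aux A hA
  obtain ⟨C, hC⟩ := hUc.isBounded.exists_norm_le
  have hb : ∀ i, ∀ u ∈ U, ‖(A ^ i) *ᵥ u‖ ≤ ‖A ^ i‖ * C := fun i u hu =>
    (Matrix.linfty_opNorm_mulVec _ _).trans
      (mul_le_mul_of_nonneg_left (hC u hu) (norm_nonneg _))
  have hsC := hs.mul_right C
  have hsum : ∀ u : ℕ → Fin d → ℝ, (∀ i, u i ∈ U) → Summable (fun i => (A ^ i) *ᵥ u i) :=
    fun u hu => Summable.of_norm_bounded hsC (fun i => hb i _ (hu i))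
  apply Set.Subset.antisymm
  · apply closure_minimal
    · rintro y ⟨m, u, hu, rfl⟩
      refine ⟨fun i => if i ≤ m then u i else 0, fun i => ?_, ?_⟩
      · by_cases h : i ≤ m
        · simpa [h] using hu i h
        · simpa [h] using h0
      · have : ∑ i ∈ Finset.range (m + 1), (A ^ i) *ᵥ u i
            = ∑ i ∈ Finset.range (m + 1), (A ^ i) *ᵥ (if i ≤ m then u i else 0) := by
          refine Finset.sum_congr rfl fun i hi => ?_
          rw [if_pos (by simpa [Nat.lt_succ_iff] using hi)]
        rw [this]
        refine hasSum_sum_of_ne_finset_zero fun i hi => ?_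
        have hi2 : ¬ i ≤ m := by simpa [Nat.lt_succ_iff] using hi
        simp [hi2]
    · have hK : IsCompact (Set.pi Set.univ (fun _ : ℕ => U)) := isCompact_univ_pi fun _ => hUc
      have hcont : ContinuousOn (fun u : ℕ → Fin d → ℝ => ∑' i, (A ^ i) *ᵥ u i)
          (Set.pi Set.univ (fun _ : ℕ => U)) := by
        refine continuousOn_tsum (fun i => ?_) hsC (fun i u hu => hb i _ (hu i trivial))
        exact (Continuous.matrix_mulVec continuous_const (continuous_apply i)).continuousOn
      convert (hK.image_of_continuousOn hcont).isClosed using 1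
      ext y
      constructor
      · rintro ⟨u, hu, hy⟩
        exact ⟨u, fun i _ => hu i, hy.tsum_eq⟩
      · rintro ⟨u, hu, rfl⟩
        exact ⟨u, fun i => hu i trivial, (hsum u fun i => hu i trivial).hasSum⟩
  · rintro y ⟨u, hu, hy⟩
    refine mem_closure_of_tendsto
      (hy.tendsto_sum_nat.comp (Filter.tendsto_add_atTop_nat 1)) (Filter.Eventually.of_forall ?_)
    exact fun m => ⟨m, u, fun i _ => hu i, rfl⟩
end

section
/- Let A ∈ ℝ^{d×d} have spectral radius ρ(A) < 1, let U ⊆ ℝ^d be a nonempty compact set, and let τ ∈ ℝ^d. Then a point x belongs to max_τ(A^∞(U)) if and only if x = ∑_{i=0}^∞ Aⁱ uᵢ for some sequence (uᵢ) in U such that Aⁱ uᵢ ∈ max_τ(Aⁱ(U)) for every i ∈ ℕ. -/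
open Matrix

/-- `max_τ(C) = { v ∈ C : ∀ w ∈ C, ⟨w, τ⟩ ≤ ⟨v, τ⟩ }`. -/
def maxIn {d : ℕ} (τ : Fin d → ℝ) (C : Set (Fin d → ℝ)) : Set (Fin d → ℝ) :=
  { v ∈ C | ∀ w ∈ C, w ⬝ᵥ τ ≤ v ⬝ᵥ τ }

/-- for `ρ(A) < 1`, `U` nonempty compact and `τ ∈ ℝ^d`, a point `x` lies in
`max_τ(A^∞(U))` iff `x = ∑_{i=0}^∞ Aⁱ uᵢ` for some sequence `(uᵢ)` in `U` with
`Aⁱ uᵢ ∈ max_τ(Aⁱ(U))` for every `i`. -/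
theorem mem_maxIn_Ainf_iff {d : ℕ} (A : Matrix (Fin d) (Fin d) ℝ)
    (hA : SpecRadiusLtOne A) (U : Set (Fin d → ℝ)) (hUne : U.Nonempty) (hUc : IsCompact U)
    (τ : Fin d → ℝ) (x : Fin d → ℝ) :
    x ∈ maxIn τ (Ainf A U) ↔
      ∃ u : ℕ → Fin d → ℝ, (∀ i, u i ∈ U) ∧
        (∀ i, (A ^ i) *ᵥ u i ∈ maxIn τ ((A ^ i).mulVec '' U)) ∧
        HasSum (fun i => (A ^ i) *ᵥ u i) x := by
  have key : ∀ (f : ℕ → Fin d → ℝ) (y : Fin d → ℝ), HasSum f y →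
      HasSum (fun i => f i ⬝ᵥ τ) (y ⬝ᵥ τ) := by
    intro f y hf
    unfold dotProduct
    refine hasSum_sum ?_
    intro j _
    exact ((Pi.hasSum.mp hf) j).mul_right (τ j)
  constructor
  · rintro ⟨⟨u, hu, hs⟩, hmax⟩
    refine ⟨u, hu, ?_, hs⟩
    intro i
    refine ⟨⟨u i, hu i, rfl⟩, ?_⟩
    rintro w ⟨v, hv, rfl⟩
    have h1 := hs.update i ((A ^ i) *ᵥ v)
    have h2 := hmax ((A ^ i) *ᵥ v - (A ^ i) *ᵥ u i + x) ⟨Function.update u i v, ?_, ?_⟩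
    · rw [add_dotProduct, sub_dotProduct] at h2
      linarith
    · intro j
      by_cases h : j = i
      · subst h; simpa using hv
      · simpa [h] using hu j
    · have h3 : (fun j => (A ^ j) *ᵥ Function.update u i v j) =
          Function.update (fun i => (A ^ i) *ᵥ u i) i ((A ^ i) *ᵥ v) := by
        funext j
        by_cases h : j = i
        · subst h; simp
        · simp [h]
      rw [h3]
      exact h1
  · rintro ⟨u, hu, hm, hs⟩
    refine ⟨⟨u, hu, hs⟩, ?_⟩
    rintro w ⟨v, hv, hw⟩
    exact hasSum_le (fun i => (hm i).2 _ ⟨v i, hv i, rfl⟩) (key _ _ hw) (key _ _ hs)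
end

section
/- Let A ∈ ℝ^{d×d} have spectral radius ρ(A) < 1, let U ⊆ ℝ^d be a nonempty compact set, and let τ ∈ ℝ^d. Then for every i ∈ ℕ, Aff₀(max_τ(Aⁱ(U))) ⊆ Aff₀(max_τ(A^∞(U))). -/
open Matrix

/-- `Aff₀(S) = { ∑_{i=1}^m λᵢ uᵢ : m ∈ ℕ, ∑ λᵢ = 0, uᵢ ∈ S }`. -/
def Aff0 {d : ℕ} (S : Set (Fin d → ℝ)) : Set (Fin d → ℝ) :=
  { x | ∃ (m : ℕ) (lam : Fin m → ℝ) (u : Fin m → Fin d → ℝ),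
      (∀ i, u i ∈ S) ∧ ∑ i, lam i = 0 ∧ x = ∑ i, lam i • u i }

theorem aux_summable_pow {B : Type*} [NormedRing B] [NormedAlgebra ℂ B] [CompleteSpace B]
    [Nontrivial B] (a : B) (h : ∀ z ∈ spectrum ℂ a, ‖z‖ < 1) :
    Summable (fun n : ℕ => ‖a ^ n‖) := by
  have h1 : spectralRadius ℂ a < ((1 : NNReal) : ENNReal) :=
    spectrum.spectralRadius_lt_of_forall_lt a (fun z hz => by
      rw [← NNReal.coe_lt_coe]; simpa using h z hz)
  obtain ⟨r, hr1, hr2⟩ := ENNReal.lt_iff_exists_nnreal_btwn.1 h1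
  have hr2' : r < 1 := by exact_mod_cast hr2
  have ht := (spectrum.pow_nnnorm_pow_one_div_tendsto_nhds_spectralRadius a).eventually_lt_const hr1
  have hg : Summable (fun n : ℕ => (r : ℝ) ^ n) :=
    summable_geometric_of_lt_one r.2 (by exact_mod_cast hr2')
  refine Summable.of_norm_bounded_eventually_nat hg ?_
  filter_upwards [ht, Filter.eventually_gt_atTop 0] with n hn hn0
  rw [norm_norm]
  have h0 : (n : ℝ) ≠ 0 := by positivity
  have h3 : ((‖a ^ n‖₊ : ENNReal) ^ (1 / n : ℝ)) ^ (n : ℝ) ≤ (r : ENNReal) ^ (n : ℝ) :=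
    ENNReal.rpow_le_rpow hn.le (by positivity)
  rw [← ENNReal.rpow_mul, one_div_mul_cancel h0, ENNReal.rpow_one, ENNReal.rpow_natCast] at h3
  exact_mod_cast h3

attribute [local instance] Matrix.linftyOpNormedRing Matrix.linftyOpNormedAlgebra

theorem aux_entry_le {d : ℕ} (M : Matrix (Fin d) (Fin d) ℂ) (i j : Fin d) :
    ‖M i j‖ ≤ ‖M‖ := by
  have h : ‖M i j‖₊ ≤ ‖M‖₊ := by
    rw [Matrix.linfty_opNNNorm_def]
    refine le_trans ?_ (Finset.le_sup (f := fun i => ∑ j, ‖M i j‖₊) (Finset.mem_univ i))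
    exact Finset.single_le_sum (f := fun j => ‖M i j‖₊) (fun _ _ => zero_le) (Finset.mem_univ j)
  exact_mod_cast h

theorem aux_summable_entry {d : ℕ} (A : Matrix (Fin d) (Fin d) ℝ)
    (hA : SpecRadiusLtOne A) (i j : Fin d) : Summable (fun n : ℕ => ‖(A ^ n) i j‖) := by
  haveI : Nonempty (Fin d) := ⟨i⟩
  haveI : CompleteSpace (Matrix (Fin d) (Fin d) ℂ) := FiniteDimensional.complete ℂ _
  have h := aux_summable_pow (A.map Complex.ofReal) hA
  refine Summable.of_nonneg_of_le (fun _ => norm_nonneg _) (fun n => ?_) h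
  refine le_trans ?_ (aux_entry_le _ i j)
  have e : (A.map Complex.ofReal) ^ n = (A ^ n).map Complex.ofReal :=
    (map_pow (Complex.ofRealHom.mapMatrix) A n).symm
  rw [e]
  simp

theorem aux_summable_vec {d : ℕ} (A : Matrix (Fin d) (Fin d) ℝ)
    (hA : SpecRadiusLtOne A) (U : Set (Fin d → ℝ)) (hUc : IsCompact U)
    (u : ℕ → Fin d → ℝ) (hu : ∀ n, u n ∈ U) : Summable (fun n => (A ^ n) *ᵥ u n) := by
  obtain ⟨R, hR⟩ := hUc.isBounded.exists_norm_le
  refine Pi.summable.2 fun k => ?_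
  simp only [Matrix.mulVec, dotProduct]
  refine summable_sum fun j _ => ?_
  refine Summable.of_norm_bounded ((aux_summable_entry A hA k j).mul_right R) fun n => ?_
  rw [norm_mul]
  exact mul_le_mul_of_nonneg_left ((norm_le_pi_norm (u n) j).trans (hR _ (hu n))) (norm_nonneg _)

theorem aux_hasSum_dot {d : ℕ} (τ : Fin d → ℝ) {f : ℕ → Fin d → ℝ} {y : Fin d → ℝ}
    (h : HasSum f y) : HasSum (fun n => f n ⬝ᵥ τ) (y ⬝ᵥ τ) := by
  simp only [dotProduct]
  exact hasSum_sum fun j _ => (Pi.hasSum.1 h j).mul_right (τ j)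

/-- for `ρ(A) < 1`, `U` nonempty compact and `τ ∈ ℝ^d`, for every `i`,
`Aff₀(max_τ(Aⁱ(U))) ⊆ Aff₀(max_τ(A^∞(U)))`. -/
theorem Aff0_maxIn_pow_subset {d : ℕ} (A : Matrix (Fin d) (Fin d) ℝ)
    (hA : SpecRadiusLtOne A) (U : Set (Fin d → ℝ)) (hUne : U.Nonempty) (hUc : IsCompact U)
    (τ : Fin d → ℝ) :
    ∀ i : ℕ, Aff0 (maxIn τ ((A ^ i).mulVec '' U)) ⊆ Aff0 (maxIn τ (Ainf A U)) := by
  intro i x hx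
  have hmax : ∀ n : ℕ, ∃ v ∈ U, ∀ w ∈ U, ((A ^ n) *ᵥ w) ⬝ᵥ τ ≤ ((A ^ n) *ᵥ v) ⬝ᵥ τ := by
    intro n
    have hc : Continuous (fun w : Fin d → ℝ => ((A ^ n) *ᵥ w) ⬝ᵥ τ) := by fun_prop
    obtain ⟨v, hv, hm⟩ := hUc.exists_isMaxOn hUne hc.continuousOn
    exact ⟨v, hv, fun w hw => hm hw⟩
  choose m hmU hm using hmax
  obtain ⟨s, hs⟩ := aux_summable_vec A hA U hUc m hmU
  have key : ∀ v ∈ maxIn τ ((A ^ i).mulVec '' U),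
      v + (s - (A ^ i) *ᵥ m i) ∈ maxIn τ (Ainf A U) := by
    rintro v ⟨⟨u, huU, rfl⟩, hv⟩
    have hsum := hs.update i ((A ^ i) *ᵥ u)
    have e : Function.update (fun n => (A ^ n) *ᵥ m n) i ((A ^ i) *ᵥ u)
        = fun n => (A ^ n) *ᵥ (Function.update m i u n) := by
      funext n
      by_cases hn : n = i
      · subst hn; simp
      · simp [hn]
    rw [e] at hsum
    have e2 : (A ^ i) *ᵥ u + (s - (A ^ i) *ᵥ m i) = (A ^ i) *ᵥ u - (A ^ i) *ᵥ m i + s := by abel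
    rw [e2]
    refine ⟨⟨Function.update m i u, fun n => ?_, hsum⟩, ?_⟩
    · by_cases hn : n = i
      · subst hn; simpa using huU
      · simpa [hn] using hmU n
    · rintro w ⟨z, hz, hw⟩
      refine hasSum_le (fun n => ?_) (aux_hasSum_dot τ hw) (aux_hasSum_dot τ hsum)
      by_cases hn : n = i
      · subst hn
        simpa using hv _ ⟨z n, hz n, rfl⟩
      · simpa [hn] using hm n _ (hz n)
  obtain ⟨k, lam, u, hu, h0, rfl⟩ := hx
  refine ⟨k, lam, fun j => u j + (s - (A ^ i) *ᵥ m i), fun j => key _ (hu j), h0, ?_⟩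
  simp only [smul_add, Finset.sum_add_distrib, ← Finset.sum_smul, h0, zero_smul, add_zero]
end

section
/- Let A ∈ ℚ^{d×d} have spectral radius ρ(A) < 1, let U ⊆ ℝ^d be the convex hull of a finite set of points with rational coordinates, and let τ ∈ ℝ^d. Then the linear subspace Aff₀(max_τ(A^∞(U))) of ℝ^d is spanned by finitely many vectors with rational coordinates. -/
open Matrix

lemma Aff0_zero {d : ℕ} (S : Set (Fin d → ℝ)) : (0 : Fin d → ℝ) ∈ Aff0 S :=
  ⟨0, Fin.elim0, Fin.elim0, fun i => i.elim0, by simp, by simp⟩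

lemma Aff0_sub {d : ℕ} {S : Set (Fin d → ℝ)} {x y : Fin d → ℝ} (hx : x ∈ S) (hy : y ∈ S) :
    x - y ∈ Aff0 S :=
  ⟨2, ![1, -1], ![x, y], by intro i; fin_cases i <;> simp [hx, hy], by simp,
    by simp [Fin.sum_univ_two, sub_eq_add_neg]⟩

lemma Aff0_smul {d : ℕ} {S : Set (Fin d → ℝ)} {x : Fin d → ℝ} (c : ℝ) (hx : x ∈ Aff0 S) :
    c • x ∈ Aff0 S := by
  obtain ⟨m, l, u, hu, hl, rfl⟩ := hx
  exact ⟨m, fun i => c * l i, u, hu, by rw [← Finset.mul_sum, hl, mul_zero],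
    by simp [Finset.smul_sum, mul_smul]⟩

lemma Aff0_add {d : ℕ} {S : Set (Fin d → ℝ)} {x y : Fin d → ℝ} (hx : x ∈ Aff0 S)
    (hy : y ∈ Aff0 S) : x + y ∈ Aff0 S := by
  obtain ⟨m, l, u, hu, hl, rfl⟩ := hx
  obtain ⟨n, l', u', hu', hl', rfl⟩ := hy
  refine ⟨m + n, Fin.append l l', Fin.append u u', ?_, ?_, ?_⟩
  · intro i
    refine Fin.addCases (fun i => ?_) (fun i => ?_) i
    · simpa using hu i
    · simpa using hu' i
  · simp [Fin.sum_univ_add, hl, hl']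
  · simp [Fin.sum_univ_add]

lemma Aff0_span {d : ℕ} {S T : Set (Fin d → ℝ)} (h : T ⊆ Aff0 S) :
    (Submodule.span ℝ T : Set (Fin d → ℝ)) ⊆ Aff0 S := by
  intro x hx
  induction hx using Submodule.span_induction with
  | mem x hx => exact h hx
  | zero => exact Aff0_zero S
  | add x y _ _ hx hy => exact Aff0_add hx hy
  | smul c x _ hx => exact Aff0_smul c hx

section
attribute [local instance] Matrix.linftyOpNormedRing Matrix.linftyOpNormedAlgebra

lemma summable_norm_pow {d : ℕ} (B : Matrix (Fin d) (Fin d) ℂ)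
    (hB : ∀ μ ∈ spectrum ℂ B, ‖μ‖ < 1) : Summable (fun i => ‖B ^ i‖) := by
  rcases Nat.eq_zero_or_pos d with rfl | hd
  · have : ∀ i, ‖B ^ i‖ = 0 := fun i => by rw [Subsingleton.elim (B ^ i) 0, norm_zero]
    simp only [this]; exact summable_zero
  have : Nonempty (Fin d) := ⟨⟨0, hd⟩⟩
  have : CompleteSpace (Matrix (Fin d) (Fin d) ℂ) := FiniteDimensional.complete ℂ _
  have h1 : spectralRadius ℂ B < ((1 : NNReal) : ENNReal) :=
    spectrum.spectralRadius_lt_of_forall_lt B (fun k hk => by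
      have := hB k hk
      exact_mod_cast this)
  obtain ⟨r, hr1, hr2⟩ := ENNReal.lt_iff_exists_nnreal_btwn.1 h1
  have h2 := (spectrum.pow_nnnorm_pow_one_div_tendsto_nhds_spectralRadius B).eventually
    (gt_mem_nhds hr1)
  have hr3 : r < 1 := by exact_mod_cast hr2
  refine Summable.of_norm_bounded_eventually_nat
    (summable_geometric_of_lt_one r.2 (by exact_mod_cast hr3)) ?_
  filter_upwards [h2, Filter.eventually_gt_atTop 0] with n hn hn0
  have h3 : ((‖B ^ n‖₊ : ENNReal)) ≤ (r : ENNReal) ^ n := by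
    rw [one_div] at hn
    have h4 := ENNReal.rpow_le_rpow hn.le (Nat.cast_nonneg n)
    rwa [ENNReal.rpow_inv_rpow (by positivity), ENNReal.rpow_natCast] at h4
  have h5 : ‖B ^ n‖₊ ≤ r ^ n := by exact_mod_cast h3
  have h6 : ‖B ^ n‖ ≤ (r : ℝ) ^ n := by exact_mod_cast h5
  rw [norm_norm]; exact h6

lemma summable_Ainf {d : ℕ} (A : Matrix (Fin d) (Fin d) ℝ) (hA : SpecRadiusLtOne A)
    (u : ℕ → Fin d → ℝ) (C : ℝ) (hu : ∀ i, ‖u i‖ ≤ C) :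
    Summable (fun i => (A ^ i) *ᵥ u i) := by
  have hs := (summable_norm_pow _ hA).mul_right C
  refine Summable.of_norm_bounded hs (fun i => ?_)
  have e : ‖(A ^ i)‖ = ‖(A.map Complex.ofReal) ^ i‖ := by
    have : (A.map Complex.ofReal) ^ i = (A ^ i).map Complex.ofReal :=
      ((Complex.ofRealHom.mapMatrix).map_pow A i).symm
    rw [this, Matrix.linfty_opNorm_def, Matrix.linfty_opNorm_def]
    simp
  rw [← e]
  exact (Matrix.linfty_opNorm_mulVec _ _).trans
    (mul_le_mul_of_nonneg_left (hu i) (norm_nonneg _))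
end

lemma face_lemma {d : ℕ} (F : Finset (Fin d → ℝ)) (f : (Fin d → ℝ) →ₗ[ℝ] ℝ) (e₀ x : Fin d → ℝ)
    (hmax : ∀ e ∈ F, f e ≤ f e₀) (hx : x ∈ convexHull ℝ (F : Set (Fin d → ℝ)))
    (hfx : f e₀ ≤ f x) :
    x - e₀ ∈ Submodule.span ℝ {z | ∃ e ∈ F, f e = f e₀ ∧ z = e - e₀} := by
  rw [Finset.mem_convexHull'] at hx
  obtain ⟨w, hw0, hw1, rfl⟩ := hx
  have h1 : ∑ e ∈ F, w e • e - e₀ = ∑ e ∈ F, w e • (e - e₀) := by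
    simp only [smul_sub, Finset.sum_sub_distrib, ← Finset.sum_smul, hw1, one_smul]
  have h2 : ∑ e ∈ F, w e * (f e₀ - f e) = 0 := by
    apply le_antisymm
    · simp only [mul_sub, Finset.sum_sub_distrib, ← Finset.sum_mul, hw1, one_mul]
      simp only [map_sum, map_smul, smul_eq_mul] at hfx
      linarith
    · exact Finset.sum_nonneg fun e he => mul_nonneg (hw0 e he) (sub_nonneg.2 (hmax e he))
  rw [Finset.sum_eq_zero_iff_of_nonneg
    (fun e he => mul_nonneg (hw0 e he) (sub_nonneg.2 (hmax e he)))] at h2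
  rw [h1]
  refine Submodule.sum_mem _ fun e he => ?_
  rcases mul_eq_zero.1 (h2 e he) with h | h
  · rw [h, zero_smul]; exact Submodule.zero_mem _
  · exact Submodule.smul_mem _ _ (Submodule.subset_span ⟨e, he, by linarith, rfl⟩)

lemma le_hull {d : ℕ} (F : Finset (Fin d → ℝ)) (f : (Fin d → ℝ) →ₗ[ℝ] ℝ) (c : ℝ)
    (hmax : ∀ e ∈ F, f e ≤ c) {x : Fin d → ℝ} (hx : x ∈ convexHull ℝ (F : Set (Fin d → ℝ))) :
    f x ≤ c :=
  convexHull_min (s := (F : Set (Fin d → ℝ))) (t := {x | f x ≤ c}) (fun e he => hmax e he)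
    (convex_halfSpace_le f.isLinear c) hx

/-- Main structural lemma. -/
lemma main_eq {d : ℕ} (A : Matrix (Fin d) (Fin d) ℝ) (hA : SpecRadiusLtOne A)
    (F : Finset (Fin d → ℝ)) (hF : F.Nonempty) (τ : Fin d → ℝ) :
    Aff0 (maxIn τ (Ainf A (convexHull ℝ (F : Set (Fin d → ℝ))))) =
      (Submodule.span ℝ {z | ∃ (i : ℕ) (e e' : Fin d → ℝ), e ∈ F ∧ e' ∈ F ∧
        (∀ g ∈ F, (A ^ i *ᵥ g) ⬝ᵥ τ ≤ (A ^ i *ᵥ e) ⬝ᵥ τ) ∧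
        (∀ g ∈ F, (A ^ i *ᵥ g) ⬝ᵥ τ ≤ (A ^ i *ᵥ e') ⬝ᵥ τ) ∧ z = A ^ i *ᵥ (e - e')} :
          Submodule ℝ (Fin d → ℝ)) := by
  set W : Submodule ℝ (Fin d → ℝ) := Submodule.span ℝ {z | ∃ (i : ℕ) (e e' : Fin d → ℝ), e ∈ F ∧ e' ∈ F ∧
        (∀ g ∈ F, (A ^ i *ᵥ g) ⬝ᵥ τ ≤ (A ^ i *ᵥ e) ⬝ᵥ τ) ∧
        (∀ g ∈ F, (A ^ i *ᵥ g) ⬝ᵥ τ ≤ (A ^ i *ᵥ e') ⬝ᵥ τ) ∧ z = A ^ i *ᵥ (e - e')} with hW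
  let f : ℕ → (Fin d → ℝ) →ₗ[ℝ] ℝ := fun i =>
    { toFun := fun x => (A ^ i *ᵥ x) ⬝ᵥ τ
      map_add' := fun x y => by rw [Matrix.mulVec_add, add_dotProduct]
      map_smul' := fun c x => by rw [Matrix.mulVec_smul, smul_dotProduct]; rfl }
  have hf : ∀ i x, f i x = (A ^ i *ᵥ x) ⬝ᵥ τ := fun _ _ => rfl
  let D : (Fin d → ℝ) →L[ℝ] ℝ := LinearMap.toContinuousLinearMap
    { toFun := fun x => x ⬝ᵥ τ
      map_add' := fun x y => by rw [add_dotProduct]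
      map_smul' := fun c x => by rw [smul_dotProduct]; rfl }
  have hD : ∀ x, D x = x ⬝ᵥ τ := fun _ => rfl
  choose e heF hemax using fun i => F.exists_max_image (f i) hF
  -- base point
  obtain ⟨y, hy⟩ := summable_Ainf A hA e (∑ g ∈ F, ‖g‖) (fun i =>
    Finset.single_le_sum (f := fun g : Fin d → ℝ => ‖g‖) (fun _ _ => norm_nonneg _) (heF i))
  have hyC : y ∈ Ainf A (convexHull ℝ (F : Set (Fin d → ℝ))) :=
    ⟨e, fun i => subset_convexHull ℝ _ (heF i), hy⟩
  have hymax : ∀ w ∈ Ainf A (convexHull ℝ (F : Set (Fin d → ℝ))), w ⬝ᵥ τ ≤ y ⬝ᵥ τ := by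
    rintro w ⟨u, hu, hw⟩
    exact hasSum_le (fun i => le_hull F (f i) _ (hemax i) (hu i)) (hw.mapL D) (hy.mapL D)
  have hyM : y ∈ maxIn τ (Ainf A (convexHull ℝ (F : Set (Fin d → ℝ)))) := ⟨hyC, hymax⟩
  -- swapping one coordinate
  have hswap : ∀ i g, g ∈ F → (∀ g' ∈ F, f i g' ≤ f i g) →
      A ^ i *ᵥ g - A ^ i *ᵥ e i + y ∈ maxIn τ (Ainf A (convexHull ℝ (F : Set (Fin d → ℝ)))) := by
    intro i g hg hgm
    refine ⟨⟨Function.update e i g, ?_, ?_⟩, ?_⟩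
    · intro j
      by_cases hj : j = i
      · subst hj; simpa using subset_convexHull ℝ _ hg
      · simpa [hj] using subset_convexHull ℝ _ (heF j)
    · have hup : (fun k => A ^ k *ᵥ Function.update e i g k) =
          Function.update (fun k => A ^ k *ᵥ e k) i (A ^ i *ᵥ g) := by
        funext j
        by_cases hj : j = i
        · subst hj; simp
        · simp [hj]
      rw [hup]
      exact hy.update i (A ^ i *ᵥ g)
    · intro w hw
      have h1 := hymax w hw
      have h2 := hgm (e i) (heF i)
      rw [hf, hf] at h2
      rw [add_dotProduct, sub_dotProduct]
      linarith
  apply Set.Subset.antisymm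
  · -- each maximal point differs from `y` by an element of `W`
    have key : ∀ v ∈ maxIn τ (Ainf A (convexHull ℝ (F : Set (Fin d → ℝ)))), v - y ∈ W := by
      rintro v ⟨⟨u, hu, hv⟩, hvm⟩
      have hfu : ∀ i, f i (e i) ≤ f i (u i) := by
        intro i
        have hz := hvm (A ^ i *ᵥ e i - A ^ i *ᵥ u i + v) ⟨Function.update u i (e i), ?_, ?_⟩
        · rw [add_dotProduct, sub_dotProduct] at hz
          rw [hf, hf]; linarith
        · intro j
          by_cases hj : j = i
          · subst hj; simpa using subset_convexHull ℝ _ (heF j)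
          · simpa [hj] using hu j
        · have hup : (fun k => A ^ k *ᵥ Function.update u i (e i) k) =
              Function.update (fun k => A ^ k *ᵥ u k) i (A ^ i *ᵥ (e i)) := by
            funext j
            by_cases hj : j = i
            · subst hj; simp
            · simp [hj]
          rw [hup]
          exact hv.update i (A ^ i *ᵥ (e i))
      have hcl : IsClosed (W : Set (Fin d → ℝ)) := W.closed_of_finiteDimensional
      have hs := hv.sub hy
      refine hcl.mem_of_tendsto hs.tendsto_sum_nat (Filter.Eventually.of_forall fun n => ?_)
      refine W.sum_mem fun i _ => ?_
      have h1 := face_lemma F (f i) (e i) (u i) (hemax i) (hu i) (hfu i)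
      rw [← Matrix.mulVec_sub]
      have h2 := Submodule.mem_map_of_mem (f := (A ^ i).mulVecLin) h1
      rw [Submodule.map_span] at h2
      refine Submodule.span_mono ?_ h2
      rintro _ ⟨_, ⟨g, hg, hge, rfl⟩, rfl⟩
      exact ⟨i, g, e i, hg, heF i, fun g' hg' => (hemax i g' hg').trans hge.ge, hemax i, rfl⟩
    rintro x ⟨m, l, u, hu, hl, rfl⟩
    have : ∑ i, l i • u i = ∑ i, l i • (u i - y) := by
      simp only [smul_sub, Finset.sum_sub_distrib, ← Finset.sum_smul, hl, zero_smul, sub_zero]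
    rw [this]
    exact W.sum_mem fun i _ => W.smul_mem _ (key _ (hu i))
  · refine Aff0_span ?_
    rintro _ ⟨i, g, g', hg, hg', hgm, hgm', rfl⟩
    have := Aff0_sub (hswap i g hg hgm) (hswap i g' hg' hgm')
    convert this using 1
    rw [Matrix.mulVec_sub]; abel

lemma finite_rat_span {d : ℕ} (T : Set (Fin d → ℝ)) (hT : ∀ z ∈ T, ∀ j, ∃ q : ℚ, z j = (q : ℝ)) :
    ∃ (m : ℕ) (v : Fin m → Fin d → ℝ), (∀ i j, ∃ q : ℚ, v i j = (q : ℝ)) ∧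
      Submodule.span ℝ T = Submodule.span ℝ (Set.range v) := by
  obtain ⟨v, hv, hs, -⟩ := Submodule.exists_fun_fin_finrank_span_eq ℝ T
  exact ⟨_, v, fun i j => hT _ (hv i) j, hs.symm⟩

theorem Aff0_maxIn_Ainf_rational_basis {d : ℕ} (A : Matrix (Fin d) (Fin d) ℚ)
    (hA : SpecRadiusLtOne (A.map (fun q : ℚ => (q : ℝ))))
    (E : Finset (Fin d → ℚ)) (τ : Fin d → ℝ) :
    ∃ (m : ℕ) (v : Fin m → Fin d → ℝ),
      (∀ i j, ∃ q : ℚ, v i j = (q : ℝ)) ∧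
      Aff0 (maxIn τ (Ainf (A.map (fun q : ℚ => (q : ℝ)))
          (convexHull ℝ ((fun q : Fin d → ℚ => fun i => (q i : ℝ)) '' ↑E)))) =
        ↑(Submodule.span ℝ (Set.range v)) := by
  classical
  rcases E.eq_empty_or_nonempty with rfl | hE
  · refine ⟨0, Fin.elim0, fun i => i.elim0, ?_⟩
    apply Set.Subset.antisymm
    · rintro x ⟨m, l, u, hu, hl, rfl⟩
      have : IsEmpty (Fin m) := ⟨fun i => by
        obtain ⟨⟨w, hw, -⟩, -⟩ := hu i
        simpa using hw 0⟩
      simp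
    · apply Aff0_span
      rintro _ ⟨i, -⟩
      exact i.elim0
  · have hco : ((fun q : Fin d → ℚ => fun i => (q i : ℝ)) '' (E : Set (Fin d → ℚ))) =
        ((E.image (fun q : Fin d → ℚ => fun i => (q i : ℝ)) : Finset (Fin d → ℝ)) :
          Set (Fin d → ℝ)) := by simp
    rw [hco, main_eq _ hA _ (hE.image _) τ]
    obtain ⟨m, v, hv, hs⟩ := finite_rat_span (d := d) (T := {z | ∃ (i : ℕ) (e e' : Fin d → ℝ),
      e ∈ E.image (fun q : Fin d → ℚ => fun i => (q i : ℝ)) ∧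
      e' ∈ E.image (fun q : Fin d → ℚ => fun i => (q i : ℝ)) ∧
        (∀ g ∈ E.image (fun q : Fin d → ℚ => fun i => (q i : ℝ)),
          ((A.map (fun q : ℚ => (q : ℝ))) ^ i *ᵥ g) ⬝ᵥ τ ≤
            ((A.map (fun q : ℚ => (q : ℝ))) ^ i *ᵥ e) ⬝ᵥ τ) ∧
        (∀ g ∈ E.image (fun q : Fin d → ℚ => fun i => (q i : ℝ)),
          ((A.map (fun q : ℚ => (q : ℝ))) ^ i *ᵥ g) ⬝ᵥ τ ≤
            ((A.map (fun q : ℚ => (q : ℝ))) ^ i *ᵥ e') ⬝ᵥ τ) ∧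
        z = (A.map (fun q : ℚ => (q : ℝ))) ^ i *ᵥ (e - e')}) (by
      rintro _ ⟨i, e, e', he, he', -, -, rfl⟩ j
      obtain ⟨p, -, rfl⟩ := Finset.mem_image.1 he
      obtain ⟨p', -, rfl⟩ := Finset.mem_image.1 he'
      have hp : (A.map (fun q : ℚ => (q : ℝ))) ^ i = (A ^ i).map (fun q : ℚ => (q : ℝ)) :=
        (((Rat.castHom ℝ).mapMatrix).map_pow A i).symm
      refine ⟨(A ^ i *ᵥ (p - p')) j, ?_⟩
      rw [hp]
      simp [Matrix.mulVec, dotProduct])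
    exact ⟨m, v, hv, by rw [hs]⟩
end

section
/- Let A ∈ ℝ^{d×d} be a matrix all of whose (complex) eigenvalues are real and strictly positive, and let w, τ ∈ ℝ^d. Then the sequence (⟨Aⁿ w, τ⟩)_{n ∈ ℕ} satisfies exactly one of: it is identically zero; it is ultimately positive (there exists N such that ⟨Aⁿ w, τ⟩ > 0 for all n ≥ N); or it is ultimately negative (there exists N such that ⟨Aⁿ w, τ⟩ < 0 for all n ≥ N). -/
open Matrix

/-- All complex eigenvalues of the real matrix `A` are real and strictly positive. -/
def EigsRealPos {d : ℕ} (A : Matrix (Fin d) (Fin d) ℝ) : Prop :=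
  ∀ μ ∈ spectrum ℂ (A.map Complex.ofReal), μ.im = 0 ∧ 0 < μ.re

theorem tri_step_pos (a : ℝ) (ha : 0 < a) (u : ℕ → ℝ) (N : ℕ)
    (h : ∀ n ≥ N, 0 < u (n+1) - a * u n) :
    (∃ N : ℕ, ∀ n ≥ N, 0 < u n) ∨ (∃ N : ℕ, ∀ n ≥ N, u n < 0) := by
  by_cases hx : ∃ m ≥ N, 0 ≤ u m
  · obtain ⟨m, hm, h0⟩ := hx
    left
    refine ⟨m + 1, fun n hn => ?_⟩
    induction n, hn using Nat.le_induction with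
    | base => nlinarith [h m hm, mul_nonneg ha.le h0]
    | succ k hk ih => nlinarith [h k (by omega), mul_pos ha ih]
  · push Not at hx
    exact Or.inr ⟨N, hx⟩

theorem tri_poly {d : ℕ} (A : Matrix (Fin d) (Fin d) ℝ) (τ : Fin d → ℝ) (s : Multiset ℝ) :
    (∀ a ∈ s, 0 < a) → ∀ w : Fin d → ℝ,
    (Polynomial.aeval A (s.map (fun a => Polynomial.X - Polynomial.C a)).prod) *ᵥ w = 0 →
    (∀ n : ℕ, ((A ^ n *ᵥ w) ⬝ᵥ τ) = 0) ∨ (∃ N : ℕ, ∀ n ≥ N, 0 < ((A ^ n *ᵥ w) ⬝ᵥ τ)) ∨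
      (∃ N : ℕ, ∀ n ≥ N, ((A ^ n *ᵥ w) ⬝ᵥ τ) < 0) := by
  induction s using Multiset.induction_on with
  | empty =>
    intro _ w hw
    left
    have : w = 0 := by simpa using hw
    simp [this]
  | cons a s ih =>
    intro hs w hw
    have ha : 0 < a := hs a (by simp)
    have key : ∀ n, (A ^ n *ᵥ (A *ᵥ w - a • w)) ⬝ᵥ τ
        = (A ^ (n+1) *ᵥ w) ⬝ᵥ τ - a * ((A ^ n *ᵥ w) ⬝ᵥ τ) := by
      intro n
      rw [mulVec_sub, mulVec_mulVec, ← pow_succ, mulVec_smul, sub_dotProduct, smul_dotProduct,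
        smul_eq_mul]
    have := ih (fun b hb => hs b (by simp [hb])) (A *ᵥ w - a • w) (by
      rw [Multiset.map_cons, Multiset.prod_cons, mul_comm, map_mul, ← mulVec_mulVec] at hw
      rw [← hw]
      congr 1
      simp [sub_mulVec, Algebra.algebraMap_eq_smul_one, smul_mulVec]
      )
    simp only [key] at this
    rcases this with h | ⟨N, h⟩ | ⟨N, h⟩
    · have hp : ∀ n, (A ^ n *ᵥ w) ⬝ᵥ τ = a ^ n * (w ⬝ᵥ τ) := by
        intro n
        induction n with
        | zero => simp
        | succ n ihn => rw [sub_eq_zero.1 (h n), ihn]; ring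
      simp only [hp]
      rcases lt_trichotomy (w ⬝ᵥ τ) 0 with h0 | h0 | h0
      · exact Or.inr (Or.inr ⟨0, fun n _ => mul_neg_of_pos_of_neg (pow_pos ha n) h0⟩)
      · left; simp [h0]
      · exact Or.inr (Or.inl ⟨0, fun n _ => mul_pos (pow_pos ha n) h0⟩)
    · exact Or.inr (tri_step_pos a ha _ N h)
    · have := tri_step_pos a ha (fun n => - ((A ^ n *ᵥ w) ⬝ᵥ τ)) N
        (fun n hn => by have := h n hn; linarith)
      simp only [Left.neg_pos_iff, Left.neg_neg_iff] at this
      exact Or.inr this.symm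

theorem charpoly_pos {d : ℕ} (A : Matrix (Fin d) (Fin d) ℝ) (hA : EigsRealPos A) :
    ∃ s : Multiset ℝ, (∀ a ∈ s, 0 < a) ∧
      A.charpoly = (s.map (fun a => Polynomial.X - Polynomial.C a)).prod := by
  set B := A.map Complex.ofReal with hB
  have hr : ∀ μ ∈ B.charpoly.roots, μ.im = 0 ∧ 0 < μ.re := by
    intro μ hμ
    exact hA μ (Matrix.mem_spectrum_of_isRoot_charpoly (Polynomial.isRoot_of_mem_roots hμ))
  refine ⟨B.charpoly.roots.map Complex.re, ?_, ?_⟩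
  · intro a ha
    obtain ⟨μ, hμ, rfl⟩ := Multiset.mem_map.1 ha
    exact (hr μ hμ).2
  · apply Polynomial.map_injective Complex.ofRealHom Complex.ofRealHom.injective
    have h1 : A.charpoly.map Complex.ofRealHom = B.charpoly :=
      (Matrix.charpoly_map A Complex.ofRealHom).symm
    rw [h1, Polynomial.map_multiset_prod]
    conv_lhs => rw [(IsAlgClosed.splits B.charpoly).eq_prod_roots_of_monic B.charpoly_monic]
    rw [Multiset.map_map, Multiset.map_map]
    congr 1
    apply Multiset.map_congr rfl
    intro μ hμ
    have : ((μ.re : ℝ) : ℂ) = μ := Complex.ext (by simp) (by simp [(hr μ hμ).1])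
    simp [this]

/-- if all eigenvalues of `A` are real and strictly positive then, for any
`w, τ ∈ ℝ^d`, the sequence `⟨Aⁿ w, τ⟩` is exactly one of: identically zero, ultimately
positive, or ultimately negative. -/
theorem trichotomy_of_real_pos_spectrum {d : ℕ} (A : Matrix (Fin d) (Fin d) ℝ)
    (hA : EigsRealPos A) (w τ : Fin d → ℝ) :
    (((∀ n : ℕ, ((A ^ n *ᵥ w) ⬝ᵥ τ) = 0) ∧
        ¬(∃ N : ℕ, ∀ n ≥ N, 0 < ((A ^ n *ᵥ w) ⬝ᵥ τ)) ∧
        ¬(∃ N : ℕ, ∀ n ≥ N, ((A ^ n *ᵥ w) ⬝ᵥ τ) < 0)) ∨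
      ((∃ N : ℕ, ∀ n ≥ N, 0 < ((A ^ n *ᵥ w) ⬝ᵥ τ)) ∧
        ¬(∀ n : ℕ, ((A ^ n *ᵥ w) ⬝ᵥ τ) = 0) ∧
        ¬(∃ N : ℕ, ∀ n ≥ N, ((A ^ n *ᵥ w) ⬝ᵥ τ) < 0)) ∨
      ((∃ N : ℕ, ∀ n ≥ N, ((A ^ n *ᵥ w) ⬝ᵥ τ) < 0) ∧
        ¬(∀ n : ℕ, ((A ^ n *ᵥ w) ⬝ᵥ τ) = 0) ∧
        ¬(∃ N : ℕ, ∀ n ≥ N, 0 < ((A ^ n *ᵥ w) ⬝ᵥ τ)))) := by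
  obtain ⟨s, hs, hc⟩ := charpoly_pos A hA
  have h := tri_poly A τ s hs w (by rw [← hc, Matrix.aeval_self_charpoly, zero_mulVec])
  have e1 : (∀ n : ℕ, ((A ^ n *ᵥ w) ⬝ᵥ τ) = 0) → ¬(∃ N : ℕ, ∀ n ≥ N, 0 < ((A ^ n *ᵥ w) ⬝ᵥ τ)) := by
    rintro h0 ⟨N, hN⟩
    exact (hN N le_rfl).ne' (h0 N)
  have e2 : (∀ n : ℕ, ((A ^ n *ᵥ w) ⬝ᵥ τ) = 0) → ¬(∃ N : ℕ, ∀ n ≥ N, ((A ^ n *ᵥ w) ⬝ᵥ τ) < 0) := by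
    rintro h0 ⟨N, hN⟩
    exact (hN N le_rfl).ne (h0 N)
  have e3 : (∃ N : ℕ, ∀ n ≥ N, 0 < ((A ^ n *ᵥ w) ⬝ᵥ τ)) →
      ¬(∃ N : ℕ, ∀ n ≥ N, ((A ^ n *ᵥ w) ⬝ᵥ τ) < 0) := by
    rintro ⟨M, hM⟩ ⟨N, hN⟩
    exact lt_asymm (hM (max M N) (le_max_left _ _)) (hN (max M N) (le_max_right _ _))
  tauto
end

section
/- Let A ∈ ℚ^{d×d} be a matrix all of whose (complex) eigenvalues are real and strictly positive, with distinct eigenvalues 0 < λ₁ < … < λ_k, and let E ⊆ ℝ^d be a finite set. Then there exist bilinear forms L_{ij} : ℝ^d × ℝ^d → ℝ (1 ≤ i ≤ k, 0 ≤ j ≤ d−1) with real algebraic coefficients satisfying ⟨Aⁿ u, τ⟩ = ∑_{i,j} C(n,j) λᵢⁿ L_{ij}(u, τ) for all u, τ ∈ ℝ^d and n ∈ ℕ, such that the following holds: for all τ, τ' ∈ ℝ^d with τ' ∈ Dom(τ) (meaning: for all u, u' ∈ E and all i, j, L_{ij}(u−u', τ) = 0 implies L_{ij}(u−u', τ') =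 0), and for all u, u' ∈ E, if the sequence (⟨Aⁿ(u−u'), τ⟩)_{n ∈ ℕ} is positive for all n (respectively, ultimately positive), then there exists ε > 0 such that (⟨Aⁿ(u−u'), τ + ε τ'⟩)_{n ∈ ℕ} is positive for all n (respectively, ultimately positive). -/
open Matrix

open Polynomial in
theorem aux_expand {F : Type*} [Field F] {d k : ℕ} (A : Matrix (Fin d) (Fin d) F)
    (lam : Fin k → F) (hinj : Function.Injective lam) (h0 : ∀ i, lam i ≠ 0)
    (hA : aeval A (∏ i, (X - C (lam i)) ^ d) = 0) :
    ∃ L : Fin k → Fin d → Matrix (Fin d) (Fin d) F,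
      ∀ n : ℕ, A ^ n = ∑ i, ∑ j : Fin d, ((n.choose (j : ℕ) : F) * lam i ^ n) • L i j := by
  classical
  rcases Nat.eq_zero_or_pos k with rfl | hk
  · have h1 : (1 : Matrix (Fin d) (Fin d) F) = 0 := by simpa using hA
    refine ⟨fun _ _ => 0, fun n => ?_⟩
    rw [← mul_one (A ^ n), h1]; simp
  have : Nonempty (Fin k) := ⟨⟨0, hk⟩⟩
  have hcop : Pairwise (Function.onFun IsCoprime fun i : Fin k => (X - C (lam i)) ^ d) := by
    intro i j hij
    exact (pairwise_coprime_X_sub_C hinj hij).pow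
  obtain ⟨μ, hμ⟩ := exists_sum_eq_one_iff_pairwise_coprime'.2 hcop
  set e : Fin k → Matrix (Fin d) (Fin d) F :=
    fun i => aeval A (μ i * ∏ j ∈ {i}ᶜ, (X - C (lam j)) ^ d) with he
  set N : Fin k → Matrix (Fin d) (Fin d) F := fun i => aeval A (X - C (lam i)) with hN
  have hsum : ∑ i, e i = 1 := by
    simp only [he]; rw [← map_sum, hμ, map_one]
  have hNe : ∀ i, N i ^ d * e i = 0 := by
    intro i
    simp only [he, hN]
    rw [← map_pow, ← map_mul]
    have : (X - C (lam i)) ^ d * (μ i * ∏ j ∈ {i}ᶜ, (X - C (lam j)) ^ d)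
        = μ i * ∏ i, (X - C (lam i)) ^ d := by
      rw [← Finset.prod_mul_prod_compl {i}, Finset.prod_singleton]; ring
    rw [this, map_mul, hA, mul_zero]
  have hAN : ∀ i, A = N i + algebraMap F _ (lam i) := by
    intro i; simp [hN]
  refine ⟨fun i j => ((lam i)⁻¹ ^ (j : ℕ)) • (N i ^ (j : ℕ) * e i), fun n => ?_⟩
  rw [← mul_one (A ^ n), ← hsum, Finset.mul_sum]
  refine Finset.sum_congr rfl fun i _ => ?_
  set G : ℕ → Matrix (Fin d) (Fin d) F := fun m =>
    ((n.choose m : F) * lam i ^ n) • ((lam i)⁻¹ ^ m) • (N i ^ m * e i) with hG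
  have hG1 : ∀ m, d ≤ m → G m = 0 := by
    intro m hm
    obtain ⟨c, rfl⟩ := Nat.exists_eq_add_of_le hm
    simp only [hG]
    rw [add_comm d c, pow_add (N i), mul_assoc, hNe]; simp
  have hG2 : ∀ m, n + 1 ≤ m → G m = 0 := by
    intro m hm
    simp only [hG]
    rw [Nat.choose_eq_zero_of_lt (by omega)]; simp
  have e1 : ∑ j : Fin d, G j = ∑ m ∈ Finset.range (n + 1 + d), G m := by
    rw [Fin.sum_univ_eq_sum_range]
    refine Finset.sum_subset (by intro x; simp; omega) fun x _ hx => hG1 x (by simpa using hx)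
  have e2 : ∑ m ∈ Finset.range (n + 1), G m = ∑ m ∈ Finset.range (n + 1 + d), G m := by
    refine Finset.sum_subset (by intro x; simp; omega) fun x _ hx => hG2 x (by simpa using hx)
  rw [show (∑ j : Fin d, ((n.choose (j : ℕ) : F) * lam i ^ n) • ((lam i)⁻¹ ^ (j : ℕ)) • (N i ^ (j : ℕ) * e i)) = ∑ j : Fin d, G j from rfl, e1, ← e2]
  conv_lhs => rw [hAN i]
  rw [Commute.add_pow (Algebra.commutes (lam i) (N i)).symm, Finset.sum_mul]
  refine Finset.sum_congr rfl fun m hm => ?_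
  have hm' : m ≤ n := by simp at hm; omega
  simp only [hG]
  rw [smul_smul, ← map_pow (algebraMap F (Matrix (Fin d) (Fin d) F)), ← map_natCast (algebraMap F (Matrix (Fin d) (Fin d) F)),
    mul_assoc (N i ^ m), ← map_mul, ← Algebra.commutes, mul_assoc, ← Algebra.smul_def]
  congr 1
  rw [inv_pow, pow_sub₀ _ (h0 i) hm']
  ring

open Asymptotics Filter in
theorem aux_dom {d k : ℕ} (lam : Fin k → ℝ) (hmono : StrictMono lam) (hpos : ∀ i, 0 < lam i)
    (c c' : Fin k → Fin d → ℝ) (hc : ∀ i j, c i j = 0 → c' i j = 0)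
    (f g : ℕ → ℝ)
    (hf : ∀ n, f n = ∑ i, ∑ j : Fin d, (n.choose (j : ℕ) : ℝ) * lam i ^ n * c i j)
    (hg : ∀ n, g n = ∑ i, ∑ j : Fin d, (n.choose (j : ℕ) : ℝ) * lam i ^ n * c' i j) :
    g =O[atTop] f := by
  classical
  let φ : Fin k ×ₗ Fin d → ℕ → ℝ := fun p n =>
    (n.choose ((ofLex p).2 : ℕ) : ℝ) * lam (ofLex p).1 ^ n
  have hchoose : ∀ j : ℕ, (fun n : ℕ => (n.choose j : ℝ)) =Θ[atTop] fun n => (n : ℝ) ^ j :=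
    fun j => isTheta_choose j
  have hφ : ∀ q p, q < p → φ q =o[atTop] φ p := by
    intro q p hqp
    rcases (Prod.Lex.lt_iff).1 hqp with h | ⟨h1, h2⟩
    · have a1 : φ q =O[atTop] fun n : ℕ => (n : ℝ) ^ ((ofLex q).2 : ℕ) * lam (ofLex q).1 ^ n :=
        (hchoose _).1.mul (isBigO_refl _ _)
      have a2 := isLittleO_pow_const_mul_const_pow_const_pow_of_norm_lt (R := ℝ)
        ((ofLex q).2 : ℕ) (r₁ := lam (ofLex q).1) (r₂ := lam (ofLex p).1) (by
          rw [Real.norm_eq_abs, abs_of_pos (hpos _)]; exact hmono h)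
      have a3 : (fun n : ℕ => lam (ofLex p).1 ^ n) =O[atTop] φ p := by
        refine IsBigO.of_bound 1 ?_
        filter_upwards [eventually_ge_atTop ((ofLex p).2 : ℕ)] with n hn
        have : (1 : ℝ) ≤ (n.choose ((ofLex p).2 : ℕ) : ℝ) := by
          exact_mod_cast Nat.choose_pos hn
        have h3 := pow_pos (hpos (ofLex p).1) n
        simp only [φ, norm_mul, Real.norm_eq_abs, abs_of_pos h3, Nat.abs_cast]
        nlinarith
      exact (a1.trans_isLittleO a2).trans_isBigO a3
    · have a2 : (fun n : ℕ => (n : ℝ) ^ ((ofLex q).2 : ℕ)) =o[atTop]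
          fun n : ℕ => (n : ℝ) ^ ((ofLex p).2 : ℕ) :=
        (isLittleO_pow_pow_atTop_of_lt (𝕜 := ℝ) h2).comp_tendsto tendsto_natCast_atTop_atTop
      have := ((hchoose _).1.trans_isLittleO a2).trans_isBigO (hchoose _).2
      have := this.mul_isBigO (isBigO_refl (fun n : ℕ => lam (ofLex p).1 ^ n) atTop)
      simp only [φ, h1]
      exact this
  let s : Fin k ×ₗ Fin d → ℝ := fun p => c (ofLex p).1 (ofLex p).2
  let s' : Fin k ×ₗ Fin d → ℝ := fun p => c' (ofLex p).1 (ofLex p).2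
  have hss : ∀ p, s p = 0 → s' p = 0 := fun p => hc _ _
  have hf' : f = fun n => ∑ p, s p * φ p n := by
    funext n
    rw [hf, ← Fintype.sum_prod_type', ← toLex.sum_comp]
    exact Finset.sum_congr rfl fun p _ => by simp [s, φ]; ring
  have hg' : g = fun n => ∑ p, s' p * φ p n := by
    funext n
    rw [hg, ← Fintype.sum_prod_type', ← toLex.sum_comp]
    exact Finset.sum_congr rfl fun p _ => by simp [s', φ]; ring
  by_cases hS : (Finset.univ.filter fun p => s p ≠ 0).Nonempty
  · obtain ⟨p, hp, hmax⟩ := Finset.exists_max_image _ id hS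
    simp only [Finset.mem_filter, Finset.mem_univ, true_and, id] at hp hmax
    have hgO : g =O[atTop] φ p := by
      rw [hg']
      refine IsBigO.fun_sum fun q _ => ?_
      by_cases hq : s q = 0
      · simp only [hss q hq, zero_mul]; exact isBigO_zero _ _
      · refine IsBigO.const_mul_left ?_ _
        rcases (hmax q hq).lt_or_eq with h | h
        · exact (hφ q p h).isBigO
        · rw [h]; exact isBigO_refl _ _
    have hfe : (fun n => f n - s p * φ p n) =o[atTop] φ p := by
      have : (fun n => f n - s p * φ p n) = fun n => ∑ q ∈ Finset.univ.erase p, s q * φ q n := by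
        funext n
        simp only [hf']
        rw [← Finset.add_sum_erase _ _ (Finset.mem_univ p)]; ring
      rw [this]
      refine IsLittleO.fun_sum fun q hq => ?_
      by_cases hq' : s q = 0
      · simp only [hq', zero_mul]; exact isLittleO_zero _ _
      · exact (hφ q p (lt_of_le_of_ne (hmax q hq') (Finset.ne_of_mem_erase hq))).const_mul_left _
    have : IsEquivalent atTop f (fun n => s p * φ p n) := by
      exact hfe.trans_isBigO (isBigO_self_const_mul hp _ _)
    exact hgO.trans ((isBigO_self_const_mul hp _ _).trans this.isBigO_symm)
  · have : ∀ p, s p = 0 := by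
      intro p; by_contra h; exact hS ⟨p, by simpa using h⟩
    rw [hg']
    simp only [fun p => hss p (this p), zero_mul, Finset.sum_const_zero]
    exact isBigO_zero _ _

open Polynomial in
theorem aux_annih {d k : ℕ} (B : Matrix (Fin d) (Fin d) ℂ) (l : Fin k → ℂ)
    (h : spectrum ℂ B = Set.range l) : aeval B (∏ i, (X - C (l i)) ^ d) = 0 := by
  have hsp := (IsAlgClosed.splits B.charpoly).eq_prod_roots_of_monic B.charpoly_monic
  have hcard : B.charpoly.roots.card = d := by
    rw [← (IsAlgClosed.splits B.charpoly).natDegree_eq_card_roots, B.charpoly_natDegree_eq_dim]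
    simp
  have key : ∀ m : Multiset ℂ, (∀ r ∈ m, r ∈ Set.range l) →
      (m.map (fun a => X - C a)).prod ∣ (∏ i, (X - C (l i))) ^ m.card := by
    intro m
    induction m using Multiset.induction_on with
    | empty => simp
    | cons a m ih =>
      intro hm
      rw [Multiset.map_cons, Multiset.prod_cons, Multiset.card_cons, pow_succ']
      refine mul_dvd_mul ?_ (ih fun r hr => hm r (Multiset.mem_cons_of_mem hr))
      obtain ⟨i, rfl⟩ := hm a (Multiset.mem_cons_self _ _)
      exact Finset.dvd_prod_of_mem (fun i => X - C (l i)) (Finset.mem_univ i)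
  have h1 := key B.charpoly.roots (by
    intro r hr
    rw [← h]
    exact Matrix.mem_spectrum_of_isRoot_charpoly (isRoot_of_mem_roots hr))
  rw [hcard, ← hsp] at h1
  rw [Finset.prod_pow]
  obtain ⟨q, hq⟩ := h1
  rw [hq, map_mul, Matrix.aeval_self_charpoly, zero_mul]

theorem aux_pert (f g : ℕ → ℝ) (h : g =O[Filter.atTop] f) :
    ((∀ n, 0 < f n) → ∃ ε > (0 : ℝ), ∀ n, 0 < f n + ε * g n) ∧
    ((∃ N, ∀ n ≥ N, 0 < f n) → ∃ ε > (0 : ℝ), ∃ N, ∀ n ≥ N, 0 < f n + ε * g n) := by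
  obtain ⟨K, hK, hb⟩ := h.exists_pos
  obtain ⟨N, hN⟩ := Filter.eventually_atTop.1 hb.bound
  have base : ∀ (ε : ℝ) (M : ℝ) (n : ℕ), 0 < ε → ε * M < 1 → |g n| ≤ M * f n → 0 < f n →
      0 < f n + ε * g n := by
    intro ε M n h1 h2 h3 h4
    have := (abs_le.1 h3).1
    nlinarith [mul_pos (sub_pos.2 h2) h4, mul_le_mul_of_nonneg_left this h1.le]
  constructor
  · intro hf
    let M : ℝ := K + ∑ m ∈ Finset.range N, |g m| / f m
    have hs : ∀ t : Finset ℕ, 0 ≤ ∑ m ∈ t, |g m| / f m :=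
      fun t => Finset.sum_nonneg fun m _ => div_nonneg (abs_nonneg _) (hf m).le
    have hM : 0 < M := add_pos_of_pos_of_nonneg hK (hs _)
    refine ⟨1 / (2 * M), by positivity, fun n => base _ M n (by positivity) ?_ ?_ (hf n)⟩
    · field_simp; norm_num
    · rcases lt_or_ge n N with h | h
      · rw [← div_le_iff₀ (hf n)]
        have := Finset.single_le_sum (f := fun m => |g m| / f m)
          (fun m _ => div_nonneg (abs_nonneg _) (hf m).le) (Finset.mem_range.2 h)
        simp only [M]; linarith
      · have h1 := hN n h
        rw [Real.norm_eq_abs, Real.norm_eq_abs, abs_of_pos (hf n)] at h1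
        refine h1.trans (mul_le_mul_of_nonneg_right ?_ (hf n).le)
        simp only [M]; linarith [hs (Finset.range N)]
  · rintro ⟨N', hf⟩
    refine ⟨1 / (2 * K), by positivity, max N N', fun n hn =>
      base _ K n (by positivity) ?_ ?_ (hf n (le_of_max_le_right hn))⟩
    · field_simp; norm_num
    · have h1 := hN n (le_of_max_le_left hn)
      rwa [Real.norm_eq_abs, Real.norm_eq_abs, abs_of_pos (hf n (le_of_max_le_right hn))] at h1

open Polynomial in
theorem aux_main {d k : ℕ} (A : Matrix (Fin d) (Fin d) ℚ)
    (lam : Fin k → ℝ) (hmono : StrictMono lam) (hpos : ∀ i, 0 < lam i)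
    (hspec : spectrum ℂ (A.map (fun q : ℚ => (q : ℂ))) = Set.range fun i => (lam i : ℂ)) :
    ∃ L : Fin k → Fin d → Matrix (Fin d) (Fin d) ℝ,
      (∀ i j a b, IsAlgebraic ℚ (L i j a b)) ∧
      (∀ (n : ℕ), (A.map (fun q : ℚ => (q : ℝ))) ^ n =
          ∑ i : Fin k, ∑ j : Fin d, ((n.choose (j : ℕ) : ℝ) * lam i ^ n) • L i j) := by
  let F := algebraicClosure ℚ ℝ
  have halg : ∀ i, IsAlgebraic ℚ (lam i) := by
    intro i
    have hmem : (lam i : ℂ) ∈ spectrum ℂ (A.map (fun q : ℚ => (q : ℂ))) := by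
      rw [hspec]; exact ⟨i, rfl⟩
    have hroot := Matrix.mem_spectrum_iff_isRoot_charpoly.1 hmem
    have hmap : (A.map (fun q : ℚ => (q : ℂ))).charpoly = A.charpoly.map (algebraMap ℚ ℂ) :=
      A.charpoly_map (algebraMap ℚ ℂ)
    have h2 : IsAlgebraic ℚ ((lam i : ℝ) : ℂ) := by
      refine ⟨A.charpoly, A.charpoly_monic.ne_zero, ?_⟩
      rw [hmap, IsRoot.def, eval_map_algebraMap] at hroot
      exact hroot
    exact (isAlgebraic_algebraMap_iff (A := ℂ) (FaithfulSMul.algebraMap_injective ℝ ℂ)).1 h2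
  let l : Fin k → F := fun i => ⟨lam i, mem_algebraicClosure_iff.2 (halg i)⟩
  let AF : Matrix (Fin d) (Fin d) F := A.map (algebraMap ℚ F)
  let ψ : F →+* ℂ := (algebraMap ℝ ℂ).comp (algebraMap F ℝ)
  have hann : aeval AF (∏ i, (X - C (l i)) ^ d) = 0 := by
    have h1 := aux_annih _ _ hspec
    have hAF : A.map (fun q : ℚ => (q : ℂ)) = ψ.mapMatrix AF := by
      ext a b; simp [AF]
    have hP : (∏ i, (X - C ((lam i : ℝ) : ℂ)) ^ d) = (∏ i, (X - C (l i)) ^ d).map ψ := by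
      simp [Polynomial.map_prod, ψ, l]
    rw [hP, hAF, aeval_def, eval₂_map] at h1
    have hinj : Function.Injective (ψ.mapMatrix (m := Fin d)) := Matrix.map_injective ψ.injective
    apply hinj
    rw [map_zero, ← h1, aeval_def, hom_eval₂]
    congr 1
    ext x a b
    simp [Matrix.algebraMap_matrix_apply]
    split_ifs <;> simp
  obtain ⟨L, hL⟩ := aux_expand AF l (fun i j h => hmono.injective (congrArg Subtype.val h))
    (fun i h => (hpos i).ne' (congrArg Subtype.val h)) hann
  refine ⟨fun i j => (algebraMap F ℝ).mapMatrix (L i j), fun i j a b =>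
    mem_algebraicClosure_iff.1 (L i j a b).2, fun n => ?_⟩
  have hAR : A.map (fun q : ℚ => (q : ℝ)) = (algebraMap F ℝ).mapMatrix AF := by
    ext a b; simp [AF]
  rw [hAR, ← map_pow, hL]
  ext a b
  simp [Matrix.sum_apply]
  rfl



/-- let `A ∈ ℚ^{d×d}` have all eigenvalues real and strictly positive,
with distinct eigenvalues `0 < λ₁ < … < λ_k`, and let `E ⊆ ℝ^d` be finite.  Then there
are bilinear forms `L_{ij}(u, τ) = τᵀ (L i j) u` with real algebraic coefficients
realizing the expansion `⟨Aⁿ u, τ⟩ = ∑_{i,j} C(n,j) λᵢⁿ L_{ij}(u, τ)` such that: for all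
`τ, τ'` with `τ' ∈ Dom(τ)` and all `u, u' ∈ E`, if `⟨Aⁿ(u−u'), τ⟩` is positive
(resp. ultimately positive) then there is `ε > 0` with `⟨Aⁿ(u−u'), τ + ε τ'⟩` positive
(resp. ultimately positive). -/
theorem perturbation_preserves_positivity {d k : ℕ} (A : Matrix (Fin d) (Fin d) ℚ)
    (lam : Fin k → ℝ) (hmono : StrictMono lam) (hpos : ∀ i, 0 < lam i)
    (hspec : spectrum ℂ (A.map (fun q : ℚ => (q : ℂ))) = Set.range fun i => (lam i : ℂ))
    (E : Finset (Fin d → ℝ)) :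
    ∃ L : Fin k → Fin d → Matrix (Fin d) (Fin d) ℝ,
      (∀ i j a b, IsAlgebraic ℚ (L i j a b)) ∧
      (∀ (u τ : Fin d → ℝ) (n : ℕ),
        ((A.map (fun q : ℚ => (q : ℝ))) ^ n *ᵥ u) ⬝ᵥ τ =
          ∑ i : Fin k, ∑ j : Fin d,
            (n.choose (j : ℕ) : ℝ) * lam i ^ n * (τ ⬝ᵥ (L i j *ᵥ u))) ∧
      ∀ τ τ' : Fin d → ℝ,
        (∀ u ∈ E, ∀ u' ∈ E, ∀ (i : Fin k) (j : Fin d),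
            τ ⬝ᵥ (L i j *ᵥ (u - u')) = 0 → τ' ⬝ᵥ (L i j *ᵥ (u - u')) = 0) →
        ∀ u ∈ E, ∀ u' ∈ E,
          ((∀ n : ℕ, 0 < ((A.map (fun q : ℚ => (q : ℝ))) ^ n *ᵥ (u - u')) ⬝ᵥ τ) →
            ∃ ε > (0 : ℝ), ∀ n : ℕ,
              0 < ((A.map (fun q : ℚ => (q : ℝ))) ^ n *ᵥ (u - u')) ⬝ᵥ (τ + ε • τ')) ∧
          ((∃ N : ℕ, ∀ n ≥ N,
              0 < ((A.map (fun q : ℚ => (q : ℝ))) ^ n *ᵥ (u - u')) ⬝ᵥ τ) →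
            ∃ ε > (0 : ℝ), ∃ N : ℕ, ∀ n ≥ N,
              0 < ((A.map (fun q : ℚ => (q : ℝ))) ^ n *ᵥ (u - u')) ⬝ᵥ (τ + ε • τ')) := by
  obtain ⟨L, hL1, hL2⟩ := aux_main A lam hmono hpos hspec
  have hexp : ∀ (u τ : Fin d → ℝ) (n : ℕ),
        ((A.map (fun q : ℚ => (q : ℝ))) ^ n *ᵥ u) ⬝ᵥ τ =
          ∑ i : Fin k, ∑ j : Fin d,
            (n.choose (j : ℕ) : ℝ) * lam i ^ n * (τ ⬝ᵥ (L i j *ᵥ u)) := by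
    intro u τ n
    rw [hL2, dotProduct_comm]
    simp only [Matrix.sum_mulVec, dotProduct_sum, Matrix.smul_mulVec, dotProduct_smul, smul_eq_mul]
  refine ⟨L, hL1, hexp, fun τ τ' hdom u hu u' hu' => ?_⟩
  have hO := aux_dom lam hmono hpos (fun i j => τ ⬝ᵥ (L i j *ᵥ (u - u')))
    (fun i j => τ' ⬝ᵥ (L i j *ᵥ (u - u'))) (hdom u hu u' hu') _ _ (hexp (u - u') τ)
    (hexp (u - u') τ')
  have := aux_pert _ _ hO
  simpa only [dotProduct_add, dotProduct_smul, smul_eq_mul] using this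
end

section
/- Let A ∈ ℚ^{d×d} have spectral radius ρ(A) < 1 and all (complex) eigenvalues real and strictly positive; let U ⊆ ℝ^d be the convex hull of a finite set of points with rational coordinates, with 0 in the relative interior of U and with the reachable set A^*(U) spanning ℝ^d; and let Q ⊆ ℝ^d be the convex hull of a nonempty finite set of points with rational coordinates. If there exists a nonzero vector τ ∈ ℝ^d such that ⟨u, τ⟩ ≤ ⟨v, τ⟩ for all u ∈ A^∞(U) and all v ∈ Q, then there exists such a nonzero vector τ all of whose coordinates are real algebraic numbers. -/
open Matrix

/-- Entrywise coercion of a rational matrix to a real matrix. -/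
def ratMat {d : ℕ} (A : Matrix (Fin d) (Fin d) ℚ) : Matrix (Fin d) (Fin d) ℝ :=
  A.map fun q : ℚ => (q : ℝ)

/-- Coercion of a rational vector to a real vector. -/
def ratVec {d : ℕ} (q : Fin d → ℚ) : Fin d → ℝ := fun i => (q i : ℝ)

noncomputable abbrev KK : IntermediateField ℚ ℝ := algebraicClosure ℚ ℝ

/-- algebraic vectors -/
def AlgV {d : ℕ} (v : Fin d → ℝ) : Prop := ∀ i, v i ∈ KK

theorem AlgV.dot {d : ℕ} {v w : Fin d → ℝ} (hv : AlgV v) (hw : AlgV w) : v ⬝ᵥ w ∈ KK :=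
  sum_mem fun i _ => mul_mem (hv i) (hw i)

theorem AlgV.sub {d : ℕ} {v w : Fin d → ℝ} (hv : AlgV v) (hw : AlgV w) : AlgV (v - w) :=
  fun i => sub_mem (hv i) (hw i)

theorem AlgV.add {d : ℕ} {v w : Fin d → ℝ} (hv : AlgV v) (hw : AlgV w) : AlgV (v + w) :=
  fun i => add_mem (hv i) (hw i)

theorem AlgV.smul {d : ℕ} {v : Fin d → ℝ} {c : ℝ} (hc : c ∈ KK) (hv : AlgV v) : AlgV (c • v) :=
  fun i => mul_mem hc (hv i)

theorem rat_mem_KK (q : ℚ) : (q : ℝ) ∈ KK := by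
  simpa using KK.algebraMap_mem q

theorem AlgV.ofRat {d : ℕ} (q : Fin d → ℚ) : AlgV (ratVec q) := fun i => rat_mem_KK _

theorem AlgV.mulVec {d : ℕ} (A : Matrix (Fin d) (Fin d) ℚ) {v : Fin d → ℝ} (hv : AlgV v) :
    AlgV (ratMat A *ᵥ v) :=
  fun i => AlgV.dot (v := fun j => ratMat A i j) (fun j => rat_mem_KK (A i j)) hv


theorem AlgV.pow {d : ℕ} (A : Matrix (Fin d) (Fin d) ℚ) {v : Fin d → ℝ} (hv : AlgV v) (n : ℕ) :
    AlgV (ratMat A ^ n *ᵥ v) := by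
  induction n with
  | zero => simpa using hv
  | succ n ih => rw [pow_succ', ← Matrix.mulVec_mulVec]; exact AlgV.mulVec A ih

open Polynomial in
theorem exists_list {d : ℕ} (A : Matrix (Fin d) (Fin d) ℚ)
    (hrad : SpecRadiusLtOne (ratMat A)) (heig : EigsRealPos (ratMat A)) :
    ∃ l : List ℝ, l.Pairwise (· ≤ ·) ∧ (∀ x ∈ l, x ∈ KK ∧ 0 < x ∧ x < 1) ∧
      aeval (ratMat A) ((l.map fun x => X - C x).prod) = 0 := by
  set p := (ratMat A).charpoly with hp
  have hpm : p.Monic := Matrix.charpoly_monic _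
  have hpC : p.map Complex.ofRealHom = ((ratMat A).map Complex.ofReal).charpoly := by
    rw [hp, ← Matrix.charpoly_map]; rfl
  have hpQ : p = A.charpoly.map (algebraMap ℚ ℝ) := by
    rw [hp, ← Matrix.charpoly_map]
    congr 1
  have hroots : ∀ z ∈ (p.map Complex.ofRealHom).roots,
      z ∈ spectrum ℂ ((ratMat A).map Complex.ofReal) := by
    intro z hz
    rw [hpC] at hz
    exact Matrix.mem_spectrum_iff_isRoot_charpoly.2 (isRoot_of_mem_roots hz)
  have hs : p.Splits := by
    refine Splits.of_splits_map Complex.ofRealHom (IsAlgClosed.splits _) ?_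
    intro z hz
    exact ⟨z.re, Complex.ext (by simp) (by simp [(heig z (hroots z hz)).1])⟩
  refine ⟨p.roots.sort (· ≤ ·), ?_, ?_, ?_⟩
  · exact Multiset.pairwise_sort _ _
  · intro x hx
    have hx' : x ∈ p.roots := by simpa using hx
    have hz : (x : ℂ) ∈ (p.map Complex.ofRealHom).roots := by
      rw [mem_roots (by simpa using (hpm.map Complex.ofRealHom).ne_zero)]
      exact (isRoot_of_mem_roots hx').map
    have h1 := hrad _ (hroots _ hz)
    have h2 := (heig _ (hroots _ hz)).2
    simp only [Complex.ofReal_re] at h2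
    rw [Complex.norm_real, Real.norm_of_nonneg h2.le] at h1
    refine ⟨?_, h2, h1⟩
    rw [mem_algebraicClosure_iff]
    refine ⟨A.charpoly, (Matrix.charpoly_monic _).ne_zero, ?_⟩
    have := isRoot_of_mem_roots hx'
    rwa [hpQ, IsRoot, eval_map_algebraMap] at this
  · have h1 : ((p.roots.sort (· ≤ ·)).map fun x => X - C x).prod = p := by
      conv_rhs => rw [hs.eq_prod_roots_of_monic hpm]
      rw [← Multiset.prod_coe, ← Multiset.map_coe, Multiset.sort_eq]
    rw [h1]
    exact Matrix.aeval_self_charpoly _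

theorem scalar_sum {s t : ℕ → ℝ} {lam : ℝ} (h0 : 0 < lam) (h1 : lam < 1)
    (hst : ∀ i, s (i + 1) = lam * s i + t i) (ht : Summable t) :
    Summable s ∧ ∑' i, s i = (s 0 + ∑' i, t i) / (1 - lam) := by
  have hs : Summable s := by
    have hta : Summable fun i => |t i| := ht.abs
    refine Summable.of_norm ?_
    refine summable_of_sum_range_le (c := (|s 0| + ∑' i, |t i|) / (1 - lam))
      (fun _ => norm_nonneg _) ?_
    intro n
    rw [le_div_iff₀ (by linarith)]
    have h2 : ∑ i ∈ Finset.range n, ‖s i‖ ≤ ∑ i ∈ Finset.range (n+1), ‖s i‖ :=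
      Finset.sum_le_sum_of_subset_of_nonneg (by simp) (fun _ _ _ => norm_nonneg _)
    rw [Finset.sum_range_succ'] at h2
    have h3 : ∑ i ∈ Finset.range n, ‖s (i+1)‖ ≤
        ∑ i ∈ Finset.range n, (lam * ‖s i‖ + |t i|) := by
      refine Finset.sum_le_sum fun i _ => ?_
      rw [hst]
      refine (norm_add_le _ _).trans ?_
      rw [norm_mul, Real.norm_of_nonneg h0.le, Real.norm_eq_abs (t i)]
    rw [Finset.sum_add_distrib, ← Finset.mul_sum] at h3
    have h4 : ∑ i ∈ Finset.range n, |t i| ≤ ∑' i, |t i| :=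
      hta.sum_le_tsum _ (fun _ _ => abs_nonneg _)
    rw [Real.norm_eq_abs (s 0)] at h2
    nlinarith
  refine ⟨hs, ?_⟩
  have h5 := hs.tsum_eq_zero_add
  simp_rw [hst] at h5
  rw [(hs.mul_left lam).tsum_add ht, tsum_mul_left] at h5
  rw [eq_div_iff (by linarith)]
  linarith

open Polynomial in
theorem list_step {d : ℕ} (M : Matrix (Fin d) (Fin d) ℝ) (lam : ℝ) (l : List ℝ) (e : Fin d → ℝ)
    (h : aeval M (((lam :: l).map fun x => X - C x).prod) *ᵥ e = 0) :
    aeval M ((l.map fun x => X - C x).prod) *ᵥ (M *ᵥ e - lam • e) = 0 := by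
  rw [List.map_cons, List.prod_cons, mul_comm, map_mul, ← Matrix.mulVec_mulVec] at h
  rw [← h]
  congr 1
  simp [Matrix.sub_mulVec, Algebra.algebraMap_eq_smul_one, Matrix.smul_mulVec]

theorem seq_step {d : ℕ} (M : Matrix (Fin d) (Fin d) ℝ) (lam : ℝ) (e τ : Fin d → ℝ) (i : ℕ) :
    (M ^ (i + 1) *ᵥ e) ⬝ᵥ τ =
      lam * ((M ^ i *ᵥ e) ⬝ᵥ τ) + (M ^ i *ᵥ (M *ᵥ e - lam • e)) ⬝ᵥ τ := by
  rw [pow_succ, ← Matrix.mulVec_mulVec, Matrix.mulVec_sub, Matrix.mulVec_smul, sub_dotProduct,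
    smul_dotProduct, smul_eq_mul]
  ring

open Polynomial in
theorem sum_alg {d : ℕ} (A : Matrix (Fin d) (Fin d) ℚ) (w : Fin d → ℝ) (hw : AlgV w)
    (l : List ℝ) (hl : ∀ x ∈ l, x ∈ KK ∧ 0 < x ∧ x < 1) :
    ∀ e : Fin d → ℝ, AlgV e → aeval (ratMat A) ((l.map fun x => X - C x).prod) *ᵥ e = 0 →
      Summable (fun i => (ratMat A ^ i *ᵥ e) ⬝ᵥ w) ∧ ∑' i, (ratMat A ^ i *ᵥ e) ⬝ᵥ w ∈ KK := by
  induction l with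
  | nil =>
    intro e he h
    have : e = 0 := by simpa using h
    subst this
    simpa using summable_zero
  | cons lam l ih =>
    intro e he h
    obtain ⟨ha, hp, h1⟩ := hl lam (by simp)
    obtain ⟨i1, i2⟩ := ih (fun x hx => hl x (by simp [hx])) _
      ((AlgV.mulVec A he).sub (he.smul ha)) (list_step _ _ _ _ h)
    obtain ⟨j1, j2⟩ := scalar_sum (s := fun i => (ratMat A ^ i *ᵥ e) ⬝ᵥ w) hp h1 (fun i => seq_step (ratMat A) lam e w i) i1
    refine ⟨j1, ?_⟩
    rw [j2]
    refine div_mem (add_mem ?_ i2) (sub_mem (one_mem _) ha)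
    exact (AlgV.pow A he 0).dot hw

open Filter Topology

theorem exists_filter {d : ℕ} (τ₀ : Fin d → ℝ) : ∃ ℱ : Filter (Fin d → ℝ), ℱ ≤ 𝓝 τ₀ ∧
    (∀ᶠ τ in ℱ, ∀ k, AlgV k → k ⬝ᵥ τ₀ = 0 → k ⬝ᵥ τ = 0) ∧ ∃ᶠ τ in ℱ, AlgV τ := by
  let S := Submodule.span KK (Set.range τ₀)
  haveI : Module.Finite KK S := Module.Finite.span_of_finite KK (Set.finite_range τ₀)
  let b := Module.finBasis KK S
  let n := Module.finrank KK S
  let t : Fin d → S := fun i => ⟨τ₀ i, Submodule.subset_span ⟨i, rfl⟩⟩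
  let w : Fin n → Fin d → KK := fun j i => b.repr (t i) j
  let f : (Fin n → ℝ) → (Fin d → ℝ) := fun q i => ∑ j, q j * (w j i : ℝ)
  let r : Fin n → ℝ := fun j => (b j : ℝ)
  have hfr : f r = τ₀ := by
    funext i
    have := congrArg (Subtype.val) (b.sum_repr (t i))
    simp only [t] at this
    rw [← this]
    simp only [f, r, w, t, AddSubmonoidClass.coe_finsetSum]
    refine Finset.sum_congr rfl fun j _ => ?_
    rw [mul_comm]; rfl
  have hfc : Continuous f := by fun_prop
  refine ⟨map f (𝓝 r), ?_, ?_, ?_⟩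
  · rw [← hfr]; exact hfc.tendsto r
  · rw [eventually_map]
    refine Eventually.of_forall fun q k hk h => ?_
    have hsw : ∀ q, k ⬝ᵥ f q = ∑ j, q j * ∑ i, k i * (w j i : ℝ) := by
      intro q
      simp only [dotProduct, f, Finset.mul_sum]
      rw [Finset.sum_comm]
      refine Finset.sum_congr rfl fun j _ => Finset.sum_congr rfl fun i _ => by ring
    let c : Fin n → KK := fun j => ∑ i, (⟨k i, hk i⟩ : KK) * w j i
    have hc : ∀ j, (c j : ℝ) = ∑ i, k i * (w j i : ℝ) := by
      intro j; simp [c]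
    have h2 : ∑ j, c j • b j = 0 := by
      apply Subtype.ext
      rw [← hfr, hsw] at h
      simp only [AddSubmonoidClass.coe_finsetSum]
      refine Eq.trans ?_ h
      refine Finset.sum_congr rfl fun j _ => ?_
      rw [← hc, mul_comm]; rfl
    have h3 := Fintype.linearIndependent_iff.1 b.linearIndependent c h2
    rw [hsw]
    refine Finset.sum_eq_zero fun j _ => ?_
    rw [← hc, h3 j]; simp
  · rw [frequently_map]
    have hd : Dense {q : Fin n → ℝ | ∀ j, q j ∈ KK} := by
      have : DenseRange (fun (q : Fin n → ℚ) j => (q j : ℝ)) :=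
        DenseRange.piMap (fun _ => Rat.denseRange_cast)
      refine this.mono ?_
      rintro _ ⟨q, rfl⟩ j
      exact rat_mem_KK _
    refine (mem_closure_iff_frequently.1 (hd r)).mono ?_
    intro q hq i
    exact sum_mem fun j _ => mul_mem (hq j) (w j i).2

theorem pos_step {d : ℕ} (M : Matrix (Fin d) (Fin d) ℝ) (ℱ : Filter (Fin d → ℝ)) (τ₀ : Fin d → ℝ)
    (hℱ : ℱ ≤ 𝓝 τ₀) (e e' : Fin d → ℝ) (lam c : ℝ) (N : ℕ) (hlam : 0 < lam) (hc : 0 < c)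
    (he : e' = M *ᵥ e - lam • e)
    (h : ∀ᶠ τ in ℱ, ∀ i ≥ N, c * lam ^ i ≤ (M ^ i *ᵥ e') ⬝ᵥ τ) :
    ∃ N', ∀ᶠ τ in ℱ, ∀ i ≥ N', 1 * lam ^ i ≤ (M ^ i *ᵥ e) ⬝ᵥ τ := by
  have hcont : Continuous fun τ : Fin d → ℝ => (M ^ N *ᵥ e) ⬝ᵥ τ := by fun_prop
  set a := (M ^ N *ᵥ e) ⬝ᵥ τ₀ with ha
  have h1 : ∀ᶠ τ in ℱ, a - 1 < (M ^ N *ᵥ e) ⬝ᵥ τ :=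
    hℱ ((hcont.tendsto τ₀).eventually_const_lt (by rw [← ha]; linarith))
  obtain ⟨m, hm⟩ := exists_nat_ge ((1 - (a - 1) / lam ^ N) / (c / lam))
  refine ⟨N + m, ?_⟩
  filter_upwards [h, h1] with τ h h1
  have key : ∀ k : ℕ, ((a - 1) / lam ^ N + k * (c / lam)) * lam ^ (N + k) ≤
      (M ^ (N + k) *ᵥ e) ⬝ᵥ τ := by
    intro k
    induction k with
    | zero => simp [div_mul_cancel₀ _ (pow_pos hlam N).ne', h1.le]
    | succ k ih =>
      rw [← add_assoc, seq_step M lam e τ (N + k), ← he]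
      have h2 := h (N + k) (by omega)
      have h3 : ((a - 1) / lam ^ N + (k + 1 : ℕ) * (c / lam)) * lam ^ (N + k + 1) =
          lam * (((a - 1) / lam ^ N + k * (c / lam)) * lam ^ (N + k)) + c * lam ^ (N + k) := by
        have : c = c / lam * lam := by field_simp
        generalize (a - 1) / lam ^ N = x
        generalize c / lam = y at *
        subst this
        push_cast
        ring
      rw [h3]
      have := mul_le_mul_of_nonneg_left ih hlam.le
      linarith
  intro i hi
  obtain ⟨k, rfl⟩ := Nat.exists_eq_add_of_le (show N ≤ i by omega)
  refine le_trans ?_ (key k)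
  gcongr
  rw [div_le_iff₀ (by positivity)] at hm
  have : (m : ℝ) * (c / lam) ≤ k * (c / lam) := by
    gcongr
    omega
  linarith

open Polynomial in
theorem trichotomy {d : ℕ} (A : Matrix (Fin d) (Fin d) ℚ) (ℱ : Filter (Fin d → ℝ))
    (τ₀ : Fin d → ℝ) (hℱ : ℱ ≤ 𝓝 τ₀)
    (hz : ∀ᶠ τ in ℱ, ∀ k, AlgV k → k ⬝ᵥ τ₀ = 0 → k ⬝ᵥ τ = 0)
    (l : List ℝ) (hs : l.Pairwise (· ≤ ·)) (hl : ∀ x ∈ l, x ∈ KK ∧ 0 < x ∧ x < 1) :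
    ∀ μ : ℝ, 0 < μ → (∀ x ∈ l, μ ≤ x) →
    ∀ e : Fin d → ℝ, AlgV e → aeval (ratMat A) ((l.map fun x => X - C x).prod) *ᵥ e = 0 →
      (∀ i, (ratMat A ^ i *ᵥ e) ⬝ᵥ τ₀ = 0) ∨
      (∃ c > 0, ∃ N, ∀ᶠ τ in ℱ, ∀ i ≥ N, c * μ ^ i ≤ (ratMat A ^ i *ᵥ e) ⬝ᵥ τ) ∨
      (∃ c > 0, ∃ N, ∀ᶠ τ in ℱ, ∀ i ≥ N, c * μ ^ i ≤ (ratMat A ^ i *ᵥ (-e)) ⬝ᵥ τ) := by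
  induction l with
  | nil =>
    intro μ hμ hμl e he h
    have : e = 0 := by simpa using h
    subst this
    left; simp
  | cons lam l ih =>
    intro μ hμ hμl e he h
    obtain ⟨ha, hp, h1⟩ := hl lam (by simp)
    have hml : μ ≤ lam := hμl lam (by simp)
    rw [List.pairwise_cons] at hs
    have he' := (AlgV.mulVec A he).sub (he.smul ha)
    have weak : ∀ c > 0, ∀ N, ∀ v : Fin d → ℝ,
        (∀ᶠ τ in ℱ, ∀ i ≥ N, c * lam ^ i ≤ (ratMat A ^ i *ᵥ v) ⬝ᵥ τ) →
        (∃ c > 0, ∃ N, ∀ᶠ τ in ℱ, ∀ i ≥ N, c * μ ^ i ≤ (ratMat A ^ i *ᵥ v) ⬝ᵥ τ) := by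
      intro c hc N v hv
      refine ⟨c, hc, N, hv.mono fun τ hτ i hi => le_trans ?_ (hτ i hi)⟩
      gcongr
    have hneg : -(ratMat A *ᵥ e - lam • e) = ratMat A *ᵥ (-e) - lam • (-e) := by
      rw [Matrix.mulVec_neg, smul_neg]; abel
    rcases ih hs.2 (fun x hx => hl x (by simp [hx])) lam hp (fun x hx => hs.1 x hx) _ he'
      (list_step _ _ _ _ h) with h2 | ⟨c, hc, N, h2⟩ | ⟨c, hc, N, h2⟩
    · have hgeo : ∀ᶠ τ in ℱ, ∀ i, (ratMat A ^ i *ᵥ e) ⬝ᵥ τ = lam ^ i * (e ⬝ᵥ τ) := by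
        filter_upwards [hz] with τ hτ i
        induction i with
        | zero => simp
        | succ i ih =>
          rw [seq_step _ lam, ih, hτ _ (AlgV.pow A he' i) (h2 i)]; ring
      have hcont : Continuous fun τ : Fin d → ℝ => e ⬝ᵥ τ := by fun_prop
      rcases lt_trichotomy (e ⬝ᵥ τ₀) 0 with h3 | h3 | h3
      · right; right
        refine weak (-(e ⬝ᵥ τ₀) / 2) (by linarith) 0 _ ?_
        have h4 : ∀ᶠ τ in ℱ, e ⬝ᵥ τ < e ⬝ᵥ τ₀ / 2 :=
          hℱ ((hcont.tendsto τ₀).eventually_lt_const (by linarith))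
        filter_upwards [hgeo, h4] with τ hτ h4 i _
        rw [Matrix.mulVec_neg, neg_dotProduct, hτ i]
        have := pow_pos hp i
        nlinarith
      · left
        intro i
        induction i with
        | zero => simpa using h3
        | succ i ih => rw [seq_step _ lam, ih, h2 i]; ring
      · right; left
        refine weak ((e ⬝ᵥ τ₀) / 2) (by linarith) 0 _ ?_
        have h4 : ∀ᶠ τ in ℱ, e ⬝ᵥ τ₀ / 2 < e ⬝ᵥ τ :=
          hℱ ((hcont.tendsto τ₀).eventually_const_lt (by linarith))
        filter_upwards [hgeo, h4] with τ hτ h4 i _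
        rw [hτ i]
        have := pow_pos hp i
        nlinarith
    · right; left
      obtain ⟨N', h3⟩ := pos_step (ratMat A) ℱ τ₀ hℱ e _ lam c N hp hc rfl h2
      exact weak 1 one_pos N' _ h3
    · right; right
      obtain ⟨N', h3⟩ := pos_step (ratMat A) ℱ τ₀ hℱ (-e) _ lam c N hp hc hneg h2
      exact weak 1 one_pos N' _ h3

/-- an algebraic linear inequality that holds at the base point persists -/
theorem persist {d : ℕ} (ℱ : Filter (Fin d → ℝ)) (τ₀ : Fin d → ℝ) (hℱ : ℱ ≤ 𝓝 τ₀)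
    (hz : ∀ᶠ τ in ℱ, ∀ k, AlgV k → k ⬝ᵥ τ₀ = 0 → k ⬝ᵥ τ = 0) (k : Fin d → ℝ) (hk : AlgV k)
    (h : 0 ≤ k ⬝ᵥ τ₀) : ∀ᶠ τ in ℱ, 0 ≤ k ⬝ᵥ τ := by
  have hcont : Continuous fun τ : Fin d → ℝ => k ⬝ᵥ τ := by fun_prop
  rcases h.eq_or_lt with h | h
  · filter_upwards [hz] with τ hτ
    exact (hτ k hk h.symm).ge
  · have h4 : ∀ᶠ τ in ℱ, 0 < k ⬝ᵥ τ := hℱ ((hcont.tendsto τ₀).eventually_const_lt h)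
    exact h4.mono fun _ h => h.le

/-- uniform eventual sign -/
theorem eventual_sign {d : ℕ} (A : Matrix (Fin d) (Fin d) ℚ)
    (hrad : SpecRadiusLtOne (ratMat A)) (heig : EigsRealPos (ratMat A))
    (ℱ : Filter (Fin d → ℝ)) (τ₀ : Fin d → ℝ) (hℱ : ℱ ≤ 𝓝 τ₀) 
    (hz : ∀ᶠ τ in ℱ, ∀ k, AlgV k → k ⬝ᵥ τ₀ = 0 → k ⬝ᵥ τ = 0) (e : Fin d → ℝ) (he : AlgV e) :
    ∃ N, (∀ᶠ τ in ℱ, ∀ i ≥ N, 0 ≤ (ratMat A ^ i *ᵥ e) ⬝ᵥ τ) ∨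
      (∀ᶠ τ in ℱ, ∀ i ≥ N, (ratMat A ^ i *ᵥ e) ⬝ᵥ τ < 0) := by
  obtain ⟨l, hs, hl, h⟩ := exists_list A hrad heig
  obtain ⟨μ, hμ, hμl⟩ : ∃ μ : ℝ, 0 < μ ∧ ∀ x ∈ l, μ ≤ x := by
    cases l with
    | nil => exact ⟨1, one_pos, by simp⟩
    | cons a l =>
      refine ⟨a, (hl a (by simp)).2.1, ?_⟩
      intro x hx
      rcases List.mem_cons.1 hx with rfl | hx
      · exact le_rfl
      · exact (List.pairwise_cons.1 hs).1 x hx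
  rcases trichotomy A ℱ τ₀ hℱ hz l hs hl μ hμ hμl e he (by rw [h]; simp) with
    h2 | ⟨c, hc, N, h2⟩ | ⟨c, hc, N, h2⟩
  · refine ⟨0, Or.inl ?_⟩
    filter_upwards [hz] with τ hτ i _
    exact (hτ _ (AlgV.pow A he i) (h2 i)).ge
  · refine ⟨N, Or.inl ?_⟩
    filter_upwards [h2] with τ hτ i hi
    exact le_trans (by positivity) (hτ i hi)
  · refine ⟨N, Or.inr ?_⟩
    filter_upwards [h2] with τ hτ i hi
    have h3 := hτ i hi
    rw [Matrix.mulVec_neg, neg_dotProduct] at h3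
    have : 0 < c * μ ^ i := by positivity
    linarith

theorem hasSum_dot {d : ℕ} {f : ℕ → Fin d → ℝ} {y : Fin d → ℝ} (h : HasSum f y) (τ : Fin d → ℝ) :
    HasSum (fun i => f i ⬝ᵥ τ) (y ⬝ᵥ τ) := by
  have h' := Pi.hasSum.1 h
  exact hasSum_sum fun j _ => (h' j).mul_right (τ j)

theorem exists_sum {d : ℕ} (A : Matrix (Fin d) (Fin d) ℚ)
    (hrad : SpecRadiusLtOne (ratMat A)) (heig : EigsRealPos (ratMat A))
    (e : Fin d → ℝ) (he : AlgV e) : ∃ y, AlgV y ∧ HasSum (fun i => ratMat A ^ i *ᵥ e) y := by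
  obtain ⟨l, hs, hl, h⟩ := exists_list A hrad heig
  have key : ∀ j, _ := fun j : Fin d => sum_alg A (Pi.single j 1)
    (by
      intro i
      rcases eq_or_ne i j with rfl | hij
      · simpa using one_mem KK
      · simpa [hij] using zero_mem KK) l hl e he (by rw [h]; simp)
  simp only [dotProduct_single, mul_one] at key
  refine ⟨fun j => ∑' i, (ratMat A ^ i *ᵥ e) j, fun j => (key j).2, ?_⟩
  exact Pi.hasSum.2 fun j => (key j).1.hasSum

theorem exists_sum_pat {d : ℕ} (A : Matrix (Fin d) (Fin d) ℚ)
    (hrad : SpecRadiusLtOne (ratMat A)) (heig : EigsRealPos (ratMat A))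
    (p : ℕ → Fin d → ℝ) (hp : ∀ i, AlgV (p i)) (N : ℕ) (e : Fin d → ℝ) (he : ∀ i ≥ N, p i = e)  :
    ∃ y, AlgV y ∧ HasSum (fun i => ratMat A ^ i *ᵥ p i) y := by
  have hee : AlgV e := he N le_rfl ▸ hp N
  obtain ⟨z, hz, hs⟩ := exists_sum A hrad heig e hee
  have h2 : HasSum (fun i => ratMat A ^ i *ᵥ (p i - e))
      (∑ i ∈ Finset.range N, ratMat A ^ i *ᵥ (p i - e)) := by
    apply hasSum_sum_of_ne_finset_zero
    intro i hi
    rw [he i (by simpa using hi)]; simp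
  refine ⟨_, ?_, (h2.add hs).congr_fun ?_⟩
  · refine AlgV.add ?_ hz
    intro j
    rw [Finset.sum_apply]
    exact sum_mem fun i _ => AlgV.pow A ((hp i).sub hee) i j
  · intro i
    simp [Matrix.mulVec_sub]

/-- for a simple LTI system (rational `A` with `ρ(A) < 1` and all
eigenvalues real strictly positive, `U` a rational polytope with `0` in its relative
interior and `A^*(U)` spanning `ℝ^d`) and a rational polytope target `Q`, if some
nonzero `τ` separates `A^∞(U)` from `Q` then some nonzero `τ` with algebraic
coordinates does. -/
theorem algebraic_separator_exists {d : ℕ} (A : Matrix (Fin d) (Fin d) ℚ)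
    (hrad : SpecRadiusLtOne (ratMat A)) (heig : EigsRealPos (ratMat A))
    (E : Finset (Fin d → ℚ)) (U : Set (Fin d → ℝ))
    (hU : U = convexHull ℝ (ratVec '' ↑E))
    (h0 : ∃ ε > 0, Metric.ball (0 : Fin d → ℝ) ε ∩ (Submodule.span ℝ U : Set (Fin d → ℝ)) ⊆ U)
    (hfull : Submodule.span ℝ (Astar (ratMat A) U) = ⊤)
    (F : Finset (Fin d → ℚ)) (hFne : F.Nonempty) (Q : Set (Fin d → ℝ))
    (hQ : Q = convexHull ℝ (ratVec '' ↑F)) :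
    (∃ τ : Fin d → ℝ, τ ≠ 0 ∧
        ∀ u ∈ Ainf (ratMat A) U, ∀ v ∈ Q, u ⬝ᵥ τ ≤ v ⬝ᵥ τ) →
    ∃ τ : Fin d → ℝ, τ ≠ 0 ∧ (∀ i, IsAlgebraic ℚ (τ i)) ∧
        ∀ u ∈ Ainf (ratMat A) U, ∀ v ∈ Q, u ⬝ᵥ τ ≤ v ⬝ᵥ τ := by
  rintro ⟨τ₀, hτ₀, hsep⟩
  have hEne : E.Nonempty := by
    rw [Finset.nonempty_iff_ne_empty]
    rintro rfl
    obtain ⟨ε, hε, h⟩ := h0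
    have : (0 : Fin d → ℝ) ∈ U := h ⟨Metric.mem_ball_self hε, Submodule.zero_mem _⟩
    simp [hU] at this
  obtain ⟨ℱ, hℱ, hz, hfreq⟩ := exists_filter τ₀
  haveI : ℱ.NeBot := ⟨fun h => hfreq (by rw [h]; exact Filter.eventually_bot)⟩
  -- maximizers at the base point
  have hmax : ∀ i : ℕ, ∃ u ∈ E, ∀ u' ∈ E,
      (ratMat A ^ i *ᵥ ratVec u') ⬝ᵥ τ₀ ≤ (ratMat A ^ i *ᵥ ratVec u) ⬝ᵥ τ₀ := fun i =>
    E.exists_max_image (fun u => (ratMat A ^ i *ᵥ ratVec u) ⬝ᵥ τ₀) hEne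
  choose m hmE hm using hmax
  have hsign : ∀ x : (Fin d → ℚ) × (Fin d → ℚ), _ := fun x =>
    eventual_sign A hrad heig ℱ τ₀ hℱ hz (ratVec x.1 - ratVec x.2)
      ((AlgV.ofRat _).sub (AlgV.ofRat _))
  choose n hn using hsign
  let N := (E ×ˢ E).sup n
  have hNle : ∀ u ∈ E, ∀ u' ∈ E, n (u, u') ≤ N := fun u hu u' hu' =>
    Finset.le_sup (f := n) (Finset.mk_mem_product hu hu')
  let p : ℕ → Fin d → ℝ := fun i => if i < N then ratVec (m i) else ratVec (m N)
  have hpalg : ∀ i, AlgV (p i) := by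
    intro i; simp only [p]; split_ifs <;> exact AlgV.ofRat _
  have hpU : ∀ i, p i ∈ U := by
    intro i; rw [hU]; apply subset_convexHull
    simp only [p]; split_ifs <;> exact ⟨_, hmE _, rfl⟩
  -- optimality of the pattern nearby
  have hopt1 : ∀ᶠ τ in ℱ, ∀ u ∈ E, ∀ i ≥ N,
      0 ≤ (ratMat A ^ i *ᵥ (ratVec (m N) - ratVec u)) ⬝ᵥ τ := by
    rw [Filter.eventually_all_finset]
    intro u hu
    rcases hn (m N, u) with h | h
    · filter_upwards [h] with τ h i hi
      exact h i ((hNle _ (hmE N) _ hu).trans hi)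
    · exfalso
      have hcl : ∃ᶠ τ in ℱ, (ratMat A ^ N *ᵥ (ratVec (m N) - ratVec u)) ⬝ᵥ τ < 0 :=
        (h.mono fun τ h => h N (hNle _ (hmE N) _ hu)).frequently
      refine hcl ?_
      have := persist ℱ τ₀ hℱ hz _ (AlgV.pow A ((AlgV.ofRat (m N)).sub (AlgV.ofRat u)) N)
        (by rw [Matrix.mulVec_sub, sub_dotProduct]; linarith [hm N u hu])
      exact this.mono fun τ h => not_lt.2 h
  have hopt2 : ∀ᶠ τ in ℱ, ∀ i ∈ Finset.range N, ∀ u ∈ E, 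
      0 ≤ (ratMat A ^ i *ᵥ (ratVec (m i) - ratVec u)) ⬝ᵥ τ := by
    rw [Filter.eventually_all_finset]
    intro i _
    rw [Filter.eventually_all_finset]
    intro u hu
    exact persist ℱ τ₀ hℱ hz _ (AlgV.pow A ((AlgV.ofRat (m i)).sub (AlgV.ofRat u)) i)
      (by rw [Matrix.mulVec_sub, sub_dotProduct]; linarith [hm i u hu])
  obtain ⟨y, hy, hys⟩ := exists_sum_pat A hrad heig p hpalg N (ratVec (m N))
    (fun i hi => by simp only [p]; rw [if_neg (by omega)])
  have hyA : y ∈ Ainf (ratMat A) U := ⟨p, hpU, hys⟩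
  have hF : ∀ᶠ τ in ℱ, ∀ v ∈ F, 0 ≤ (ratVec v - y) ⬝ᵥ τ := by
    rw [Filter.eventually_all_finset]
    intro v hv
    refine persist ℱ τ₀ hℱ hz _ ((AlgV.ofRat v).sub hy) ?_
    have := hsep y hyA (ratVec v) (by rw [hQ]; exact subset_convexHull _ _ ⟨v, hv, rfl⟩)
    rw [sub_dotProduct]; linarith
  have hne : ∀ᶠ τ in ℱ, τ ≠ 0 := hℱ (isOpen_ne.mem_nhds hτ₀)
  obtain ⟨τ, hτalg, h1, h2, h3, h4⟩ :=
    (hfreq.and_eventually (hopt1.and (hopt2.and (hF.and hne)))).exists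
  refine ⟨τ, h4, fun i => mem_algebraicClosure_iff.1 (hτalg i), ?_⟩
  rintro x ⟨u, hu, hxs⟩ v hv
  have hxy : x ⬝ᵥ τ ≤ y ⬝ᵥ τ := by
    refine hasSum_le (fun i => ?_) (hasSum_dot hxs τ) (hasSum_dot hys τ)
    have hlin : IsLinearMap ℝ fun w : Fin d → ℝ => (ratMat A ^ i *ᵥ w) ⬝ᵥ τ :=
      ⟨fun a b => by rw [Matrix.mulVec_add, add_dotProduct],
        fun c a => by rw [Matrix.mulVec_smul, smul_dotProduct]⟩
    have hsub : U ⊆ {w | (ratMat A ^ i *ᵥ w) ⬝ᵥ τ ≤ (ratMat A ^ i *ᵥ p i) ⬝ᵥ τ} := by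
      rw [hU]
      refine convexHull_min ?_ (convex_halfSpace_le hlin _)
      rintro _ ⟨w, hw, rfl⟩
      simp only [Set.mem_setOf_eq, p]
      split_ifs with hi
      · have := h2 i (by simpa using hi) w hw
        rw [Matrix.mulVec_sub, sub_dotProduct] at this; linarith
      · have := h1 w hw i (by omega)
        rw [Matrix.mulVec_sub, sub_dotProduct] at this; linarith
    exact hsub (hu i)
  have hlin : IsLinearMap ℝ fun w : Fin d → ℝ => w ⬝ᵥ τ :=
    ⟨fun a b => by rw [add_dotProduct], fun c a => by rw [smul_dotProduct]⟩
  have hsub : Q ⊆ {w | y ⬝ᵥ τ ≤ w ⬝ᵥ τ} := by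
    rw [hQ]
    refine convexHull_min ?_ (convex_halfSpace_ge hlin _)
    rintro _ ⟨w, hw, rfl⟩
    have := h3 w hw
    rw [sub_dotProduct] at this
    simp only [Set.mem_setOf_eq]; linarith
  exact hxy.trans (hsub hv)
end

section
/- Let A ∈ ℝ^{d×d} be a matrix all of whose (complex) eigenvalues are real and strictly positive, let E ⊆ ℝ^d be a nonempty finite set, and let τ ∈ ℝ^d. Then there exists u ∈ E such that for every v ∈ E, the sequence (⟨Aⁿ(u−v), τ⟩)_{n ∈ ℕ} is either identically zero or ultimately positive (there exists N such that ⟨Aⁿ(u−v), τ⟩ > 0 for all n ≥ N). -/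
open Matrix

def shiftOp : Module.End ℝ (ℕ → ℝ) where
  toFun f := fun n => f (n + 1)
  map_add' _ _ := rfl
  map_smul' _ _ := rfl

def Tri (s : ℕ → ℝ) : Prop :=
  (∀ n, s n = 0) ∨ (∃ N, ∀ n ≥ N, 0 < s n) ∨ (∃ N, ∀ n ≥ N, s n < 0)

theorem tri_step_pos_s18 (l : ℝ) (hl : 0 < l) (s : ℕ → ℝ)
    (h : ∃ N, ∀ n ≥ N, 0 < s (n + 1) - l * s n) : Tri s := by
  obtain ⟨N, hN⟩ := h
  by_cases hm : ∃ m ≥ N, 0 ≤ s m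
  · obtain ⟨m, hm, hs⟩ := hm
    refine Or.inr (Or.inl ⟨m + 1, fun n hn => ?_⟩)
    induction n, hn using Nat.le_induction with
    | base => nlinarith [hN m hm, mul_nonneg hl.le hs]
    | succ n hn ih => nlinarith [hN n (by omega), mul_pos hl ih]
  · push Not at hm
    exact Or.inr (Or.inr ⟨N, hm⟩)

theorem tri_neg (s : ℕ → ℝ) (h : Tri (fun n => - s n)) : Tri s := by
  rcases h with h | ⟨N, h⟩ | ⟨N, h⟩
  · exact Or.inl fun n => neg_eq_zero.1 (h n)
  · exact Or.inr (Or.inr ⟨N, fun n hn => by have := h n hn; simp only at this; linarith⟩)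
  · exact Or.inr (Or.inl ⟨N, fun n hn => by have := h n hn; simp only at this; linarith⟩)

theorem tri_step (l : ℝ) (hl : 0 < l) (s : ℕ → ℝ)
    (h : Tri (fun n => s (n + 1) - l * s n)) : Tri s := by
  rcases h with h | h | ⟨N, h⟩
  · have hs : ∀ n, s n = l ^ n * s 0 := by
      intro n
      induction n with
      | zero => simp
      | succ n ih => have := h n; simp only at this; rw [pow_succ]; linear_combination this + l * ih
    rcases lt_trichotomy (s 0) 0 with h0 | h0 | h0
    · exact Or.inr (Or.inr ⟨0, fun n _ => by
        rw [hs]; exact mul_neg_of_pos_of_neg (pow_pos hl n) h0⟩)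
    · exact Or.inl fun n => by rw [hs, h0, mul_zero]
    · exact Or.inr (Or.inl ⟨0, fun n _ => by rw [hs]; exact mul_pos (pow_pos hl n) h0⟩)
  · exact tri_step_pos_s18 l hl s h
  · exact tri_neg s (tri_step_pos_s18 l hl _ ⟨N, fun n hn => by
      have := h n hn; simp only at this; linarith⟩)

open Polynomial in
theorem tri_poly_s18 (k : ℕ) : ∀ p : ℝ[X], p.natDegree = k → p ≠ 0 →
    (∀ z : ℂ, (p.map Complex.ofRealHom).IsRoot z → z.im = 0 ∧ 0 < z.re) →
    ∀ s : ℕ → ℝ, aeval shiftOp p s = 0 → Tri s := by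
  induction k with
  | zero =>
    intro p hp h0 _ s hs
    obtain ⟨c, rfl⟩ := natDegree_eq_zero.1 hp
    have hc : c ≠ 0 := fun h => h0 (by simp [h])
    left
    intro n
    have := congrFun hs n
    simpa [Module.algebraMap_end_apply, hc] using this
  | succ k ih =>
    intro p hp h0 hr s hs
    obtain ⟨z, hz⟩ := Complex.exists_root (f := p.map Complex.ofRealHom) (by
      rw [degree_map]; exact natDegree_pos_iff_degree_pos.1 (by omega))
    obtain ⟨him, hre⟩ := hr z hz
    have hzz : z = Complex.ofRealHom z.re := by
      apply Complex.ext <;> simp [him]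
    have hroot : p.IsRoot z.re := by
      rw [hzz] at hz
      exact hz.of_map Complex.ofRealHom.injective
    obtain ⟨q, rfl⟩ := dvd_iff_isRoot.2 hroot
    have hq0 : q ≠ 0 := right_ne_zero_of_mul h0
    apply tri_step z.re hre
    apply ih q
    · rw [natDegree_mul (X_sub_C_ne_zero _) hq0, natDegree_X_sub_C] at hp
      omega
    · exact hq0
    · intro w hw
      apply hr w
      rw [Polynomial.map_mul]
      exact root_mul_left_of_isRoot _ hw
    · rw [mul_comm, map_mul, Module.End.mul_apply] at hs
      rw [← hs]
      congr 1
      ext n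
      simp [shiftOp, Module.algebraMap_end_apply]

open Polynomial in
theorem aeval_shift {d : ℕ} (A : Matrix (Fin d) (Fin d) ℝ) (w τ : Fin d → ℝ) (p : ℝ[X]) :
    aeval shiftOp p (fun n => (A ^ n *ᵥ w) ⬝ᵥ τ) =
      fun n => ((A ^ n * aeval A p) *ᵥ w) ⬝ᵥ τ := by
  induction p using Polynomial.induction_on' with
  | add p q hp hq =>
    ext n
    simp only [map_add, LinearMap.add_apply, hp, hq, Pi.add_apply, mul_add, add_mulVec,
      add_dotProduct]
  | monomial k c =>
    have h : ∀ (k : ℕ) (f : ℕ → ℝ) (n : ℕ), (shiftOp ^ k) f n = f (n + k) := by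
      intro k
      induction k with
      | zero => intro f n; rfl
      | succ k ih =>
        intro f n
        rw [pow_succ, Module.End.mul_apply, ih]
        rfl
    ext n
    rw [aeval_monomial, aeval_monomial, Module.End.mul_apply, Module.algebraMap_end_apply,
      Pi.smul_apply, h, ← Algebra.smul_def, mul_smul_comm, ← pow_add, smul_mulVec, smul_dotProduct]

theorem tri_matrix {d : ℕ} (A : Matrix (Fin d) (Fin d) ℝ)
    (hA : EigsRealPos A) (w τ : Fin d → ℝ) : Tri (fun n => (A ^ n *ᵥ w) ⬝ᵥ τ) := by
  apply tri_poly_s18 _ A.charpoly rfl A.charpoly_monic.ne_zero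
  · intro z hz
    apply hA
    rw [← Matrix.charpoly_map] at hz
    exact Matrix.mem_spectrum_iff_isRoot_charpoly.2 hz
  · rw [aeval_shift, Matrix.aeval_self_charpoly]
    ext n
    simp

/-- if all eigenvalues of `A` are real and strictly positive and
`E ⊆ ℝ^d` is a nonempty finite set, then for any `τ` there is `u ∈ E` such that for
every `v ∈ E` the sequence `⟨Aⁿ(u − v), τ⟩` is identically zero or ultimately
positive. -/
theorem exists_eventual_maximizer {d : ℕ} (A : Matrix (Fin d) (Fin d) ℝ)
    (hA : EigsRealPos A) (E : Finset (Fin d → ℝ)) (hE : E.Nonempty) (τ : Fin d → ℝ) :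
    ∃ u ∈ E, ∀ v ∈ E,
      (∀ n : ℕ, ((A ^ n *ᵥ (u - v)) ⬝ᵥ τ) = 0) ∨
      (∃ N : ℕ, ∀ n ≥ N, 0 < ((A ^ n *ᵥ (u - v)) ⬝ᵥ τ)) := by
  classical
  induction hE using Finset.Nonempty.cons_induction with
  | singleton a =>
    refine ⟨a, by simp, fun v hv => Or.inl fun n => ?_⟩
    rw [Finset.mem_singleton.1 hv]
    simp
  | cons a E ha hE ih =>
    obtain ⟨u, hu, h⟩ := ih
    rcases tri_matrix A hA (u - a) τ with h0 | h0 | ⟨N, h0⟩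
    · refine ⟨u, by simp [hu], fun v hv => ?_⟩
      rcases Finset.mem_cons.1 hv with rfl | hv
      · exact Or.inl h0
      · exact h v hv
    · refine ⟨u, by simp [hu], fun v hv => ?_⟩
      rcases Finset.mem_cons.1 hv with rfl | hv
      · exact Or.inr h0
      · exact h v hv
    · refine ⟨a, by simp, fun v hv => ?_⟩
      rcases Finset.mem_cons.1 hv with rfl | hv
      · exact Or.inl fun n => by simp
      · right
        have key : ∀ n, (A ^ n *ᵥ (a - v)) ⬝ᵥ τ =
            (A ^ n *ᵥ (u - v)) ⬝ᵥ τ - (A ^ n *ᵥ (u - a)) ⬝ᵥ τ := by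
          intro n
          rw [← sub_dotProduct, ← mulVec_sub]
          congr 2
          abel
        rcases h v hv with h1 | ⟨M, h1⟩
        · refine ⟨N, fun n hn => ?_⟩
          have := h0 n hn
          simp only at this
          rw [key, h1]
          linarith
        · refine ⟨max N M, fun n hn => ?_⟩
          have := h0 n (le_trans (le_max_left _ _) hn)
          have h2 := h1 n (le_trans (le_max_right _ _) hn)
          simp only at this
          rw [key]
          linarith
end

section
/- Let θ ∈ ℝ, let A = (1/2)·[[cos θ, −sin θ], [sin θ, cos θ]] ∈ ℝ^{2×2}, let U = [0,1] × {0} ⊆ ℝ², and let τ = (1, 0). Then the supremum of ⟨x, τ⟩ over x ∈ A^∞(U) equals ∑_{n=0}^∞ max(0, 2^{−n} cos(nθ)). -/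
open Matrix

theorem rot_pow (θ : ℝ) (n : ℕ) :
    ((1 / 2 : ℝ) • !![Real.cos θ, -Real.sin θ; Real.sin θ, Real.cos θ]) ^ n =
      ((1 / 2 : ℝ) ^ n) • !![Real.cos (n * θ), -Real.sin (n * θ); Real.sin (n * θ), Real.cos (n * θ)] := by
  induction n with
  | zero =>
    ext i j
    fin_cases i <;> fin_cases j <;> simp
  | succ k ih =>
    rw [pow_succ, ih]
    have h : ((k + 1 : ℕ) : ℝ) * θ = k * θ + θ := by push_cast; ring
    rw [h, Real.cos_add, Real.sin_add]
    ext i j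
    fin_cases i <;> fin_cases j <;> simp [Matrix.mul_apply, Fin.sum_univ_two, pow_succ] <;> ring

theorem rot_vec (θ : ℝ) (n : ℕ) (p : Fin 2 → ℝ) (hp : p 1 = 0) :
    (((1 / 2 : ℝ) • !![Real.cos θ, -Real.sin θ; Real.sin θ, Real.cos θ]) ^ n) *ᵥ p =
      ![(1 / 2 : ℝ) ^ n * Real.cos (n * θ) * p 0, (1 / 2 : ℝ) ^ n * Real.sin (n * θ) * p 0] := by
  rw [rot_pow]
  ext i
  fin_cases i <;> simp [Matrix.mulVec, dotProduct, Fin.sum_univ_two, hp]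

theorem summable_geo_mul (f : ℕ → ℝ) (hf : ∀ n, |f n| ≤ 1) :
    Summable (fun n => (1 / 2 : ℝ) ^ n * f n) := by
  refine Summable.of_norm_bounded (g := fun n => (1 / 2 : ℝ) ^ n) summable_geometric_two ?_
  intro n
  rw [Real.norm_eq_abs, abs_mul, abs_of_pos (by positivity : (0 : ℝ) < (1 / 2) ^ n)]
  exact mul_le_of_le_one_right (by positivity) (hf n)

/-- for the contracted rotation `A = (1/2)·R_θ`, `U = [0,1] × {0}` and
`τ = (1,0)`, the supremum of `⟨x, τ⟩` over `x ∈ A^∞(U)` is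
`∑_{n=0}^∞ max(0, 2^{−n} cos(nθ))`. -/
theorem sup_of_rotated_system (θ : ℝ) :
    sSup ((fun x : Fin 2 → ℝ => x ⬝ᵥ ![(1 : ℝ), 0]) ''
        Ainf ((1 / 2 : ℝ) • !![Real.cos θ, -Real.sin θ; Real.sin θ, Real.cos θ])
          { p : Fin 2 → ℝ | p 0 ∈ Set.Icc (0 : ℝ) 1 ∧ p 1 = 0 }) =
      ∑' n : ℕ, max 0 ((1 / 2 : ℝ) ^ n * Real.cos (n * θ)) := by
  have hpos : ∀ n : ℕ, (0 : ℝ) < (1 / 2) ^ n := fun n => by positivity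
  have hmax : Summable (fun n : ℕ => max 0 ((1 / 2 : ℝ) ^ n * Real.cos (n * θ))) := by
    have h := (summable_geo_mul (fun n => Real.cos (n * θ)) (fun n => Real.abs_cos_le_one _)).abs
    refine Summable.of_nonneg_of_le (fun n => le_max_left _ _) (fun n => ?_) h
    exact max_le (abs_nonneg _) (le_abs_self _)
  apply IsGreatest.csSup_eq
  constructor
  · let c : ℕ → ℝ := fun n => if 0 ≤ Real.cos (n * θ) then 1 else 0
    have hc0 : ∀ n, 0 ≤ c n ∧ c n ≤ 1 := fun n => by
      simp only [c]; split_ifs <;> norm_num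
    have hb : ∀ (x : ℝ) n, |x| ≤ 1 → |x * c n| ≤ 1 := fun x n hx => by
      rw [abs_mul, abs_of_nonneg (hc0 n).1]
      exact mul_le_one₀ hx (hc0 n).1 (hc0 n).2
    have h2 := summable_geo_mul (fun n => Real.sin (n * θ) * c n)
      (fun n => hb _ n (Real.abs_sin_le_one _))
    refine ⟨![∑' n : ℕ, max 0 ((1 / 2 : ℝ) ^ n * Real.cos (n * θ)),
      ∑' n : ℕ, (1 / 2 : ℝ) ^ n * (Real.sin (n * θ) * c n)], ⟨fun n => ![c n, 0], ?_, ?_⟩, ?_⟩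
    · intro n
      exact ⟨hc0 n, rfl⟩
    · have : ∀ n : ℕ, (1 / 2 : ℝ) ^ n * Real.cos (n * θ) * c n =
          max 0 ((1 / 2 : ℝ) ^ n * Real.cos (n * θ)) := fun n => by
        simp only [c]
        split_ifs with h
        · rw [mul_one, max_eq_right (mul_nonneg (hpos n).le h)]
        · rw [mul_zero, max_eq_left (mul_nonpos_of_nonneg_of_nonpos (hpos n).le (not_le.1 h).le)]
      rw [Pi.hasSum]
      intro i
      fin_cases i
      · convert hmax.hasSum using 1
        ext n
        rw [rot_vec θ n _ rfl, ← this n]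
        simp
        rfl
      · convert h2.hasSum using 1
        ext n
        rw [rot_vec θ n _ rfl]
        simp [mul_assoc]
        rfl
    · simp
  · rintro _ ⟨x, ⟨u, hu, hx⟩, rfl⟩
    have h0 := (Pi.hasSum.1 hx) 0
    have e : (x ⬝ᵥ ![(1 : ℝ), 0]) = x 0 := by simp [dotProduct, Fin.sum_univ_two]
    simp only [e]
    refine hasSum_le (fun n => ?_) h0 hmax.hasSum
    rw [rot_vec θ n _ (hu n).2]
    have h1 := (hu n).1.1
    have h2 := (hu n).1.2
    simp only [Matrix.cons_val_zero]
    rcases le_total 0 ((1 / 2 : ℝ) ^ n * Real.cos (n * θ)) with h | h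
    · exact (mul_le_of_le_one_right h h2).trans (le_max_right _ _)
    · exact (mul_nonpos_of_nonpos_of_nonneg h h1).trans (le_max_left _ _)
end
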